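/- arXiv:1804.06148 — 7 statements merged into one kernel-verified Lean document; each statement's English description precedes it below -/
import Mathlib

section
/- For every β ∈ [0,1): the series Z(β) := Σ_{ℓ=0}^∞ β^ℓ / g(ℓ)! converges; the mean R(β) := Σ_{n=0}^∞ n θ_β(n) is finite; R(0) = 0; R is strictly increasing on [0,1); and R(β) → +∞ as β → 1⁻. -/
open Filter Set

/-- The mean of the power-series distribution on `ℕ` with weights `n ↦ x ^ n * w n`. -/
noncomputable def powerSeriesMean (w : ℕ → ℝ) (x : ℝ) : ℝ :=
  (∑' n : ℕ, (n : ℝ) * (x ^ n * w n)) / ∑' n : ℕ, x ^ n * w n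

theorem summable_natCast_mul_pow_mul_of_ratio_tendsto_one {w : ℕ → ℝ} (hw : ∀ n, 0 < w n)
    (hratio : Tendsto (fun n => w (n + 1) / w n) atTop (nhds 1)) {x : ℝ} (hx : x ∈ Ico (0 : ℝ) 1) :
    Summable fun n : ℕ => (n : ℝ) * (x ^ n * w n) := by
  rcases hx.1.eq_or_lt with rfl | hx0
  · refine summable_of_ne_finset_zero (s := {0}) fun n hn => ?_
    simp_all
  · refine summable_of_ratio_test_tendsto_lt_one hx.2 ?_ ?_
    · filter_upwards [eventually_gt_atTop 0] with n hn
      have := hw n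
      positivity
    · have h1 : Tendsto (fun n : ℕ => 1 + 1 / (n : ℝ)) atTop (nhds (1 + 0)) :=
        tendsto_const_nhds.add tendsto_one_div_atTop_nhds_zero_nat
      have h2 := (h1.mul hratio).mul_const x
      rw [add_zero, one_mul, one_mul] at h2
      refine h2.congr' ?_
      filter_upwards [eventually_gt_atTop 0] with n hn
      have := hw n
      have := hw (n + 1)
      rw [Real.norm_of_nonneg (by positivity), Real.norm_of_nonneg (by positivity)]
      push_cast
      field_simp
      ring

theorem summable_pow_mul_of_summable_natCast_mul {w : ℕ → ℝ} (hw : ∀ n, 0 < w n) {x : ℝ}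
    (hx : 0 ≤ x) (h : Summable fun n : ℕ => (n : ℝ) * (x ^ n * w n)) :
    Summable fun n : ℕ => x ^ n * w n := by
  rw [← summable_nat_add_iff 1] at h ⊢
  refine h.of_nonneg_of_le (fun n => ?_) fun n => ?_
  · have := hw (n + 1)
    positivity
  · have := hw (n + 1)
    refine le_mul_of_one_le_left (by positivity) ?_
    push_cast
    linarith [(n.cast_nonneg : (0 : ℝ) ≤ n)]

theorem tsum_pow_mul_pos {w : ℕ → ℝ} (hw : ∀ n, 0 < w n) {x : ℝ} (hx : 0 ≤ x)
    (h : Summable fun n : ℕ => x ^ n * w n) : 0 < ∑' n : ℕ, x ^ n * w n :=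
  h.tsum_pos (fun n => mul_nonneg (pow_nonneg hx n) (hw n).le) 0 (by simpa using hw 0)

theorem powerSeriesMean_zero (w : ℕ → ℝ) : powerSeriesMean w 0 = 0 := by
  have : ∀ n : ℕ, (n : ℝ) * (0 ^ n * w n) = 0 := fun n => by
    rcases eq_or_ne n 0 with rfl | hn <;> simp_all
  simp [powerSeriesMean, this]

theorem powerSeriesMean_pos {w : ℕ → ℝ} (hw : ∀ n, 0 < w n) {x : ℝ} (hx : 0 < x)
    (h : Summable fun n : ℕ => (n : ℝ) * (x ^ n * w n)) : 0 < powerSeriesMean w x := by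
  refine div_pos (h.tsum_pos (fun n => ?_) 1 ?_)
    (tsum_pow_mul_pos hw hx.le (summable_pow_mul_of_summable_natCast_mul hw hx.le h))
  · have := hw n
    positivity
  · have := hw 1
    simp
    positivity

theorem sub_mul_rpow_lt_sub_mul_rpow {r : ℝ} (hr : 1 < r) {s t : ℝ} (hst : s ≠ t) :
    (s - t) * r ^ t < (s - t) * r ^ s := by
  rcases hst.lt_or_gt with h | h
  · exact mul_lt_mul_of_neg_left (Real.rpow_lt_rpow_of_exponent_lt hr h) (sub_neg.2 h)
  · exact mul_lt_mul_of_pos_left (Real.rpow_lt_rpow_of_exponent_lt hr h) (sub_pos.2 h)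

theorem powerSeriesMean_strictMonoOn {w : ℕ → ℝ} (hw : ∀ n, 0 < w n) {s : Set ℝ}
    (hs : ∀ x ∈ s, 0 ≤ x) (h : ∀ x ∈ s, Summable fun n : ℕ => (n : ℝ) * (x ^ n * w n)) :
    StrictMonoOn (powerSeriesMean w) s := by
  intro a ha b hb hab
  rcases (hs a ha).eq_or_lt with rfl | ha0
  · rw [powerSeriesMean_zero]
    exact powerSeriesMean_pos hw hab (h b hb)
  have hb0 := ha0.trans hab
  have hsum : ∀ x ∈ s, Summable fun n : ℕ => x ^ n * w n := fun x hx =>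
    summable_pow_mul_of_summable_natCast_mul hw (hs x hx) (h x hx)
  have hm := powerSeriesMean_pos hw ha0 (h a ha)
  set m := powerSeriesMean w a with hm_def
  have hcentered : ∀ x ∈ s, HasSum (fun n : ℕ => ((n : ℝ) - m) * (x ^ n * w n))
      (∑' n : ℕ, (n : ℝ) * (x ^ n * w n) - m * ∑' n : ℕ, x ^ n * w n) := fun x hx => by
    simpa only [sub_mul] using (h x hx).hasSum.sub ((hsum x hx).hasSum.mul_left m)
  have hzero : ∑' n : ℕ, (n : ℝ) * (a ^ n * w n) - m * ∑' n : ℕ, a ^ n * w n = 0 := by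
    rw [hm_def, powerSeriesMean, div_mul_cancel₀ _ (tsum_pow_mul_pos hw ha0.le (hsum a ha)).ne',
      sub_self]
  have hr : 1 < b / a := (one_lt_div ha0).2 hab
  have hterm : ∀ n : ℕ, ((n : ℝ) - m) * (b ^ n * w n)
      = ((n : ℝ) - m) * (b / a) ^ (n : ℝ) * (a ^ n * w n) := fun n => by
    rw [Real.rpow_natCast, div_pow]
    field_simp
  have hpos : ∀ n : ℕ, 0 < a ^ n * w n := fun n => mul_pos (pow_pos ha0 n) (hw n)
  have hterm' : ∀ n : ℕ, (b / a) ^ m * (((n : ℝ) - m) * (a ^ n * w n))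
      = ((n : ℝ) - m) * (b / a) ^ m * (a ^ n * w n) := fun n => by ring
  have hlt := hasSum_lt (i := 0) (fun n => ?_) ?_ ((hcentered a ha).mul_left ((b / a) ^ m))
    (hcentered b hb)
  · rw [hzero, mul_zero, sub_pos] at hlt
    exact (lt_div_iff₀ (tsum_pow_mul_pos hw hb0.le (hsum b hb))).2 hlt
  · rw [hterm, hterm']
    refine mul_le_mul_of_nonneg_right ?_ (hpos n).le
    rcases eq_or_ne (n : ℝ) m with hnm | hnm
    · rw [hnm]
    · exact (sub_mul_rpow_lt_sub_mul_rpow hr hnm).le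
  · rw [hterm, hterm']
    refine mul_lt_mul_of_pos_right (sub_mul_rpow_lt_sub_mul_rpow hr ?_) (hpos 0)
    simpa using hm.ne

theorem natCast_mul_pow_le_powerSeriesMean {w : ℕ → ℝ} (hw : ∀ n, 0 < w n) (hmono : Monotone w)
    {x : ℝ} (hx : 0 ≤ x) (h : Summable fun n : ℕ => (n : ℝ) * (x ^ n * w n)) (N : ℕ) :
    N * x ^ N ≤ powerSeriesMean w x := by
  have hsum := summable_pow_mul_of_summable_natCast_mul hw hx h
  refine (le_div_iff₀ (tsum_pow_mul_pos hw hx hsum)).2 ?_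
  rw [← tsum_mul_left]
  calc ∑' n : ℕ, N * x ^ N * (x ^ n * w n)
      ≤ ∑' n : ℕ, ((n + N : ℕ) : ℝ) * (x ^ (n + N) * w (n + N)) := by
        refine (hsum.mul_left _).tsum_le_tsum (fun n => ?_) ((summable_nat_add_iff N).2 h)
        have := (hw n).le
        calc N * x ^ N * (x ^ n * w n) = N * (x ^ (n + N) * w n) := by ring
          _ ≤ _ := by
            gcongr
            · omega
            · exact hmono (by omega)
    _ ≤ ∑' n : ℕ, (n : ℝ) * (x ^ n * w n) := by
        rw [← h.sum_add_tsum_nat_add N]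
        refine le_add_of_nonneg_left (Finset.sum_nonneg fun n _ => ?_)
        have := (hw n).le
        positivity

theorem tendsto_powerSeriesMean_atTop {w : ℕ → ℝ} (hw : ∀ n, 0 < w n) (hmono : Monotone w)
    (h : ∀ x ∈ Ico (0 : ℝ) 1, Summable fun n : ℕ => (n : ℝ) * (x ^ n * w n)) :
    Tendsto (powerSeriesMean w) (nhdsWithin 1 (Ico (0 : ℝ) 1)) atTop := by
  refine tendsto_atTop.2 fun C => ?_
  obtain ⟨N, hN⟩ := exists_nat_gt C
  have hlim : Tendsto (fun x : ℝ => N * x ^ N) (nhdsWithin 1 (Ico (0 : ℝ) 1)) (nhds N) := by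
    have : Continuous fun x : ℝ => N * x ^ N := by fun_prop
    simpa using (this.tendsto 1).mono_left nhdsWithin_le_nhds
  filter_upwards [hlim.eventually_const_lt hN, self_mem_nhdsWithin] with x hx hx'
  exact hx.le.trans (natCast_mul_pow_le_powerSeriesMean hw hmono hx'.1 (h x hx') N)

/-- For every `β ∈ [0,1)`: the series `Z(β) = Σ β^ℓ/g(ℓ)!` converges;
the mean `R(β) = Σ n θ_β(n)` is finite; `R(0) = 0`; `R` is strictly increasing on `[0,1)`;
and `R(β) → +∞` as `β → 1⁻`. -/
theorem statement0
    (g : ℕ → ℝ) (hg_mono : Monotone g) (hg0 : g 0 = 0) (hg1 : 0 < g 1)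
    (hg_lim : Filter.Tendsto g Filter.atTop (nhds 1))
    (hg_sup : (⨆ n, g n) = 1)
    (gfact : ℕ → ℝ) (hgfact : ∀ n, gfact n = ∏ k ∈ Finset.range n, g (k + 1))
    (Z : ℝ → ℝ) (hZ : ∀ β, Z β = ∑' ℓ : ℕ, β ^ ℓ / gfact ℓ)
    (θ : ℝ → ℕ → ℝ) (hθ : ∀ β n, θ β n = (Z β)⁻¹ * β ^ n / gfact n)
    (R : ℝ → ℝ) (hR : ∀ β, R β = ∑' n : ℕ, (n : ℝ) * θ β n) :
    (∀ β ∈ Set.Ico (0 : ℝ) 1, Summable fun ℓ : ℕ => β ^ ℓ / gfact ℓ) ∧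
    (∀ β ∈ Set.Ico (0 : ℝ) 1, Summable fun n : ℕ => (n : ℝ) * θ β n) ∧
    R 0 = 0 ∧
    StrictMonoOn R (Set.Ico (0 : ℝ) 1) ∧
    Filter.Tendsto R (nhdsWithin 1 (Set.Ico (0 : ℝ) 1)) Filter.atTop := by
  have hpos : ∀ n, 0 < g (n + 1) := fun n => hg1.trans_le (hg_mono (by omega))
  have hle : ∀ n, g n ≤ 1 := fun n => hg_mono.ge_of_tendsto hg_lim n
  have hfpos : ∀ n, 0 < gfact n := fun n => by
    rw [hgfact]
    exact Finset.prod_pos fun k _ => hpos k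
  have hfsucc : ∀ n, gfact (n + 1) = gfact n * g (n + 1) := fun n => by
    rw [hgfact, hgfact, Finset.prod_range_succ]
  have hw : ∀ n, 0 < (gfact n)⁻¹ := fun n => inv_pos.2 (hfpos n)
  have hmono : Monotone fun n => (gfact n)⁻¹ := monotone_nat_of_le_succ fun n => by
    refine inv_anti₀ (hfpos _) ?_
    rw [hfsucc]
    exact mul_le_of_le_one_right (hfpos n).le (hle _)
  have hratio : Tendsto (fun n => (gfact (n + 1))⁻¹ / (gfact n)⁻¹) atTop (nhds 1) := by
    have hinv := ((tendsto_add_atTop_iff_nat 1).2 hg_lim).inv₀ one_ne_zero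
    rw [inv_one] at hinv
    refine hinv.congr fun n => ?_
    have := hfpos n
    have := hpos n
    rw [hfsucc]
    field_simp
  have hsum : ∀ x ∈ Ico (0 : ℝ) 1, Summable fun n : ℕ => (n : ℝ) * (x ^ n * (gfact n)⁻¹) :=
    fun x hx => summable_natCast_mul_pow_mul_of_ratio_tendsto_one hw hratio hx
  have hterm : ∀ x (n : ℕ), (n : ℝ) * θ x n = (Z x)⁻¹ * (n * (x ^ n * (gfact n)⁻¹)) :=
    fun x n => by rw [hθ]; ring
  have hRmean : R = powerSeriesMean fun n => (gfact n)⁻¹ := by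
    funext x
    rw [hR]
    simp only [hterm, tsum_mul_left, powerSeriesMean, hZ, div_eq_mul_inv]
    ring
  refine ⟨fun x hx => ?_, fun x hx => ?_, ?_, ?_, ?_⟩
  · simpa only [div_eq_mul_inv] using
      summable_pow_mul_of_summable_natCast_mul hw hx.1 (hsum x hx)
  · simpa only [hterm] using (hsum x hx).mul_left (Z x)⁻¹
  · rw [hRmean, powerSeriesMean_zero]
  · rw [hRmean]
    exact powerSeriesMean_strictMonoOn hw (fun x hx => hx.1) hsum
  · rw [hRmean]
    exact tendsto_powerSeriesMean_atTop hw hmono hsum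
end

section
/- Let p ∈ (1/2,1], q := 1−p, and l < r' < r be integers, and κ : ℤ → [0,1]. Define κ' : ℤ → ℝ by κ'(x) := κ(x) for x ≠ r' and κ'(r') := λ^{κ,l,r}(r'). Then λ^{κ',l,r'}(x) = λ^{κ,l,r}(x) for every integer x ∈ [l,r']. -/
open Filter Set

/-- Let `p ∈ (1/2,1]`, `q := 1−p`, `l < r' < r` integers, `κ : ℤ → [0,1]`.
Define `κ'` equal to `κ` off `r'` with `κ'(r') := λ^{κ,l,r}(r')`. Then
`λ^{κ',l,r'}(x) = λ^{κ,l,r}(x)` for every integer `x ∈ [l,r']`. -/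
theorem statement9
    (p q : ℝ) (hp : 1 / 2 < p) (hp1 : p ≤ 1) (hq : q = 1 - p)
    (l r' r : ℤ) (hlr' : l < r') (hr'r : r' < r)
    (κ : ℤ → ℝ) (hκ : ∀ x, κ x ∈ Set.Icc (0 : ℝ) 1)
    (lam : ℤ → ℝ)
    (hlam : ∀ x : ℤ, lam x =
      (κ r - κ l) / (1 - (q / p) ^ (r - l).toNat) * (q / p) ^ (r - x).toNat +
      (κ l - κ r * (q / p) ^ (r - l).toNat) / (1 - (q / p) ^ (r - l).toNat))
    (κ' : ℤ → ℝ)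
    (hκ'off : ∀ x : ℤ, x ≠ r' → κ' x = κ x)
    (hκ'r' : κ' r' = lam r')
    (lam' : ℤ → ℝ)
    (hlam' : ∀ x : ℤ, lam' x =
      (κ' r' - κ' l) / (1 - (q / p) ^ (r' - l).toNat) * (q / p) ^ (r' - x).toNat +
      (κ' l - κ' r' * (q / p) ^ (r' - l).toNat) / (1 - (q / p) ^ (r' - l).toNat)) :
    ∀ x : ℤ, l ≤ x → x ≤ r' → lam' x = lam x := by
  intro x hlx hxr'
  have hp0 : 0 < p := by linarith
  have hρ0 : 0 ≤ q / p := div_nonneg (by linarith) hp0.le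
  have hρ1 : q / p < 1 := by rw [div_lt_one hp0]; linarith
  generalize q / p = ρ at *
  have hl : κ' l = κ l := hκ'off l hlr'.ne
  have hN : (r - l).toNat = (r - r').toNat + (r' - l).toNat := by omega
  have hx : (r - x).toNat = (r - r').toNat + (r' - x).toNat := by omega
  have hD : 1 - ρ ^ (r - l).toNat ≠ 0 :=
    (sub_pos.2 (pow_lt_one₀ hρ0 hρ1 (by omega))).ne'
  have hD' : 1 - ρ ^ (r' - l).toNat ≠ 0 :=
    (sub_pos.2 (pow_lt_one₀ hρ0 hρ1 (by omega))).ne'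
  rw [hlam', hκ'r', hl, hlam r', hlam x, hx]
  rw [hN] at hD ⊢
  simp only [pow_add] at hD ⊢
  generalize ρ ^ (r - r').toNat = c at *
  generalize ρ ^ (r' - l).toNat = a at *
  generalize ρ ^ (r' - x).toNat = y at *
  field_simp
  ring
end

section
/- Let p ∈ (1/2,1], q := 1−p, l < r be integers with r ≥ l+2, κ : ℤ → (0,1], and suppose λ^{κ,l,r}(x) < κ(x) for every integer x ∈ (l,r). Let μ^{κ,l,r} be the product probability measure on ℕ^{(l,r)∩ℤ} whose marginal at site x is θ_{λ^{κ,l,r}(x)/κ(x)}. Then μ^{κ,l,r} is invariant for the open zero-range generator: for every bounded measurable f : ℕ^{(l,r)∩ℤ} → ℝ, ∫ L^{κ,l,r} f dμ^{κ,l,r} = 0, where L^{κ,l,r} f(η) := Σ_{x=l+1}^{r−2} p κ(x) g(η(x)) [f(η^{x,x+1}) − f(η)] + Σ_{x=l+1}^{r−2} q κ(x+1) g(η(x+1)) [f(η^{x+1,x}) − f(η)] + q κ(l+1) g(η(l+1)) [f(η − δ_{l+1}) − f(η)] + p κ(r−1) g(η(r−1)) [f(η − δ_{r−1}) − f(η)]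 + p κ(l) [f(η + δ_{l+1}) − f(η)] + q κ(r) [f(η + δ_{r−1}) − f(η)]. -/
open Filter Set MeasureTheory

/-- The configuration obtained from `η` after a particle jumps from `x` to `y`
(`η^{x,y} = η − δ_x + δ_y`). -/
def moveConf (η : ℤ → ℕ) (x y : ℤ) : ℤ → ℕ :=
  fun z => if z = x then η x - 1 else if z = y then η y + 1 else η z

/-- The configuration `η − δ_x` (a particle is removed at `x`). -/
def removeConf (η : ℤ → ℕ) (x : ℤ) : ℤ → ℕ :=
  Function.update η x (η x - 1)

/-- The configuration `η + δ_x` (a particle is created at `x`). -/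
def addConf (η : ℤ → ℕ) (x : ℤ) : ℤ → ℕ :=
  Function.update η x (η x + 1)

/-- The set of configurations which agree with `ζ` on the finite set of sites `S`. -/
def cylinderAt (S : Finset ℤ) (ζ : ℤ → ℕ) : Set (ℤ → ℕ) := {η | ∀ x ∈ S, η x = ζ x}

/-- Extension of a configuration on `S` by zero outside `S`. -/
def extendConf (S : Finset ℤ) (ζ : S → ℕ) : ℤ → ℕ :=
  fun x => if h : x ∈ S then ζ ⟨x, h⟩ else 0

lemma extendConf_of_mem {S : Finset ℤ} {x : ℤ} (h : x ∈ S) (ζ : S → ℕ) :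
    extendConf S ζ x = ζ ⟨x, h⟩ := by
  simp [extendConf, h]

lemma DependsOn.apply_extendConf_restrict {S : Finset ℤ} {F : (ℤ → ℕ) → ℝ}
    (hF : DependsOn F (S : Set ℤ)) (η : ℤ → ℕ) :
    F (extendConf S (S.restrict η)) = F η :=
  hF fun _ hx => extendConf_of_mem (Finset.mem_coe.1 hx) _

lemma cylinderAt_extendConf (S : Finset ℤ) (ζ : S → ℕ) :
    cylinderAt S (extendConf S ζ) = S.restrict (π := fun _ => ℕ) ⁻¹' {ζ} := by
  ext η
  simp only [cylinderAt, mem_ofPred_eq, mem_preimage, mem_singleton_iff, funext_iff, Subtype.forall,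
    Finset.restrict_def]
  exact forall₂_congr fun x hx => by rw [extendConf_of_mem hx]

section LocalFunctions

variable {S : Finset ℤ} {μ : Measure (ℤ → ℕ)} [IsProbabilityMeasure μ] {F : (ℤ → ℕ) → ℝ} {C : ℝ}

lemma DependsOn.integrable_of_bounded (hF : DependsOn F (S : Set ℤ)) (hC : ∀ η, |F η| ≤ C) :
    Integrable F μ := by
  have hm : Measurable F := by
    have : F = (F ∘ extendConf S) ∘ S.restrict (π := fun _ => ℕ) :=
      funext fun η => (hF.apply_extendConf_restrict η).symm
    rw [this]
    exact Measurable.of_discrete.comp (Finset.measurable_restrict S)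
  exact Integrable.of_bound hm.aestronglyMeasurable C (ae_of_all _ hC)

lemma DependsOn.integral_eq_tsum (hF : DependsOn F (S : Set ℤ)) (hC : ∀ η, |F η| ≤ C) :
    ∫ η, F η ∂μ =
      ∑' ζ : S → ℕ, μ.real (cylinderAt S (extendConf S ζ)) * F (extendConf S ζ) := by
  have hr : Measurable (S.restrict (π := fun _ => ℕ)) := Finset.measurable_restrict S
  have : IsProbabilityMeasure (μ.map (S.restrict (π := fun _ => ℕ))) :=
    Measure.isProbabilityMeasure_map hr.aemeasurable
  have hd : Measurable (F ∘ extendConf S) := Measurable.of_discrete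
  have hint : Integrable (F ∘ extendConf S) (μ.map (S.restrict (π := fun _ => ℕ))) :=
    Integrable.of_bound hd.aestronglyMeasurable C (ae_of_all _ fun _ => hC _)
  calc ∫ η, F η ∂μ = ∫ η, (F ∘ extendConf S) (S.restrict η) ∂μ :=
        integral_congr_ae (ae_of_all _ fun η => (hF.apply_extendConf_restrict η).symm)
    _ = ∫ ζ, (F ∘ extendConf S) ζ ∂(μ.map (S.restrict (π := fun _ => ℕ))) :=
        (integral_map hr.aemeasurable hd.aestronglyMeasurable).symm
    _ = _ := by
        rw [integral_countable hint]
        refine tsum_congr fun ζ => ?_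
        rw [cylinderAt_extendConf, measureReal_def, measureReal_def,
          Measure.map_apply hr (measurableSet_singleton _)]
        rfl

end LocalFunctions

lemma removeConf_addConf (η : ℤ → ℕ) (x : ℤ) : removeConf (addConf η x) x = η := by
  simp [removeConf, addConf]

lemma moveConf_addConf (η : ℤ → ℕ) {x y : ℤ} (hxy : x ≠ y) :
    moveConf (addConf η x) x y = addConf η y := by
  ext z
  simp only [moveConf, addConf, Function.update_apply]
  split_ifs <;> simp_all

lemma addConf_extendConf {S : Finset ℤ} {x : ℤ} (hx : x ∈ S) (ζ : S → ℕ) :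
    addConf (extendConf S ζ) x =
      extendConf S (Function.update ζ ⟨x, hx⟩ (ζ ⟨x, hx⟩ + 1)) := by
  ext z
  by_cases hz : z ∈ S
  · by_cases hzx : z = x
    · subst hzx
      simp [addConf, extendConf, hx]
    · simp [addConf, extendConf, hz, hzx]
  · have hzx : z ≠ x := fun h => hz (h ▸ hx)
    simp [addConf, extendConf, hz, hzx]

section Locality

variable {S : Finset ℤ} {f : (ℤ → ℕ) → ℝ}

lemma DependsOn.comp_addConf (hf : DependsOn f (S : Set ℤ)) {x : ℤ} (hx : x ∈ S) :
    DependsOn (fun η => f (addConf η x)) (S : Set ℤ) := by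
  intro η η' h
  refine hf fun z hz => ?_
  simp only [addConf, Function.update_apply, h x (Finset.mem_coe.2 hx), h z hz]

lemma DependsOn.comp_removeConf (hf : DependsOn f (S : Set ℤ)) {x : ℤ} (hx : x ∈ S) :
    DependsOn (fun η => f (removeConf η x)) (S : Set ℤ) := by
  intro η η' h
  refine hf fun z hz => ?_
  simp only [removeConf, Function.update_apply, h x (Finset.mem_coe.2 hx), h z hz]

lemma DependsOn.comp_moveConf (hf : DependsOn f (S : Set ℤ)) {x y : ℤ} (hx : x ∈ S)
    (hy : y ∈ S) : DependsOn (fun η => f (moveConf η x y)) (S : Set ℤ) := by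
  intro η η' h
  refine hf fun z hz => ?_
  simp only [moveConf, h x (Finset.mem_coe.2 hx), h y (Finset.mem_coe.2 hy), h z hz]

end Locality

/-- Detailed balance of the cylinder weights at `x` gives the change of variables
`∫ g(η(x)) G(η) = b ∫ G(η + δ_x)` for bounded local `G`. -/
lemma integral_rate_mul {S : Finset ℤ} {μ : Measure (ℤ → ℕ)} [IsProbabilityMeasure μ]
    {g : ℕ → ℝ} (hg0 : g 0 = 0) (hg : ∀ n, |g n| ≤ 1) {x : ℤ} (hx : x ∈ S) {b : ℝ}
    (hbal : ∀ ζ, μ.real (cylinderAt S (addConf ζ x)) * g (ζ x + 1) = b * μ.real (cylinderAt S ζ))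
    {G : (ℤ → ℕ) → ℝ} (hG : DependsOn G (S : Set ℤ)) {C : ℝ} (hC : ∀ η, |G η| ≤ C) :
    Integrable (fun η => g (η x) * G η) μ ∧
      ∫ η, g (η x) * G η ∂μ = b * ∫ η, G (addConf η x) ∂μ := by
  have hloc : DependsOn (fun η : ℤ → ℕ => g (η x) * G η) (S : Set ℤ) := by
    intro η η' h
    simp only [h x (Finset.mem_coe.2 hx), hG h]
  have hbd : ∀ η : ℤ → ℕ, |g (η x) * G η| ≤ C := fun η => by
    rw [abs_mul]
    exact (mul_le_of_le_one_left (abs_nonneg _) (hg _)).trans (hC η)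
  refine ⟨hloc.integrable_of_bounded hbd, ?_⟩
  rw [hloc.integral_eq_tsum hbd, (hG.comp_addConf hx).integral_eq_tsum fun η => hC _,
    ← tsum_mul_left]
  let T : (S → ℕ) → (S → ℕ) := fun ζ => Function.update ζ ⟨x, hx⟩ (ζ ⟨x, hx⟩ + 1)
  have hT : Function.Injective T := by
    intro ζ ζ' h
    ext z
    have hz := congrFun h z
    by_cases hzx : z = ⟨x, hx⟩
    · subst hzx
      simpa [T] using hz
    · simpa [T, Function.update_apply, hzx] using hz
  rw [← hT.tsum_eq]
  · refine tsum_congr fun ζ => ?_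
    have h := hbal (extendConf S ζ)
    have hval : addConf (extendConf S ζ) x x = extendConf S ζ x + 1 := by simp [addConf]
    rw [show extendConf S (T ζ) = addConf (extendConf S ζ) x from (addConf_extendConf hx ζ).symm,
      hval, ← mul_assoc, h, mul_assoc]
  · intro ζ hζ
    have hpos : ζ ⟨x, hx⟩ ≠ 0 := by
      intro h0
      apply hζ
      simp [extendConf_of_mem hx, h0, hg0]
    refine ⟨Function.update ζ ⟨x, hx⟩ (ζ ⟨x, hx⟩ - 1), ?_⟩
    simp [T, Nat.sub_add_cancel (Nat.one_le_iff_ne_zero.2 hpos)]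

lemma sum_Icc_int_sub (a : ℤ → ℝ) (m : ℤ) (n : ℕ) :
    ∑ x ∈ Finset.Icc m (m + n - 1), (a (x + 1) - a x) = a (m + n) - a m := by
  induction n with
  | zero => simp
  | succ n ih =>
    have : Finset.Icc m (m + (n + 1 : ℕ) - 1) = insert (m + n) (Finset.Icc m (m + n - 1)) := by
      ext z
      simp only [Finset.mem_Icc, Finset.mem_insert]
      push_cast
      omega
    rw [this, Finset.sum_insert (by simp), ih]
    push_cast
    rw [← add_assoc]
    ring

section Profile

variable {p q : ℝ} {l r : ℤ} {κ lam : ℤ → ℝ}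

lemma profile_flux (hp : p ≠ 0)
    {A B : ℝ} (hlam : ∀ x, lam x = A * (q / p) ^ (r - x).toNat + B) {x : ℤ} (hx : x < r) :
    p * lam x - q * lam (x + 1) = (p - q) * B := by
  have h : (r - x).toNat = (r - (x + 1)).toNat + 1 := by omega
  rw [hlam, hlam, h, pow_succ]
  field_simp
  ring

lemma profile_pos {ρ a b : ℝ} (hρ0 : 0 ≤ ρ) (hρ1 : ρ < 1) (ha : 0 < a) (hb : 0 < b)
    {n N : ℕ} (hn : 0 < n) (hnN : n ≤ N) :
    0 < (b - a) / (1 - ρ ^ N) * ρ ^ n + (a - b * ρ ^ N) / (1 - ρ ^ N) := by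
  have h1 : ρ ^ N ≤ ρ ^ n := pow_le_pow_of_le_one hρ0 hρ1.le hnN
  have h2 : ρ ^ n < 1 := pow_lt_one₀ hρ0 hρ1 hn.ne'
  have hD : 0 < 1 - ρ ^ N := by linarith
  have : (b - a) / (1 - ρ ^ N) * ρ ^ n + (a - b * ρ ^ N) / (1 - ρ ^ N) =
      (b * (ρ ^ n - ρ ^ N) + a * (1 - ρ ^ n)) / (1 - ρ ^ N) := by
    field_simp
    ring
  rw [this]
  have := mul_nonneg hb.le (sub_nonneg.2 h1)
  have := mul_pos ha (sub_pos.2 h2)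
  positivity

end Profile

/-- Adding a particle at `x` multiplies the product weight by `β x / g (ζ x + 1)`. -/
lemma prod_weight_addConf {S : Finset ℤ} {g : ℕ → ℝ} {w : ℤ → ℕ → ℝ} {β : ℤ → ℝ} {x : ℤ}
    (hx : x ∈ S) (hg : ∀ n, 0 ≤ g n) (hβ : 0 ≤ β x)
    (hw : ∀ n, w x (n + 1) * g (n + 1) = β x * w x n) (ζ : ℤ → ℕ) :
    (∏ z ∈ S, ENNReal.ofReal (w z (addConf ζ x z))).toReal * g (ζ x + 1) =
      β x * (∏ z ∈ S, ENNReal.ofReal (w z (ζ z))).toReal := by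
  have hrest : ∏ z ∈ S.erase x, ENNReal.ofReal (w z (addConf ζ x z)) =
      ∏ z ∈ S.erase x, ENNReal.ofReal (w z (ζ z)) :=
    Finset.prod_congr rfl fun z hz => by simp [addConf, Finset.ne_of_mem_erase hz]
  have hval : addConf ζ x x = ζ x + 1 := by simp [addConf]
  rw [← Finset.mul_prod_erase S _ hx, ← Finset.mul_prod_erase S _ hx, hrest, hval,
    ENNReal.toReal_mul, ENNReal.toReal_mul, ENNReal.toReal_ofReal', ENNReal.toReal_ofReal',
    mul_right_comm, ← mul_assoc, max_mul_of_nonneg _ _ (hg _), mul_max_of_nonneg _ _ hβ, hw]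
  simp

/-- Under the condition `λ^{κ,l,r}(x) < κ(x)` on `(l,r)`, the product
measure `μ^{κ,l,r}` with marginal `θ_{λ^{κ,l,r}(x)/κ(x)}` at each site `x ∈ (l,r)` is
invariant for the open zero-range generator `L^{κ,l,r}`: for every bounded measurable
(local) `f`, `∫ L^{κ,l,r} f dμ^{κ,l,r} = 0`. -/
theorem statement10
    (g : ℕ → ℝ) (hg_mono : Monotone g) (hg0 : g 0 = 0) (hg1 : 0 < g 1)
    (hg_lim : Filter.Tendsto g Filter.atTop (nhds 1))
    (hg_sup : (⨆ n, g n) = 1)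
    (gfact : ℕ → ℝ) (hgfact : ∀ n, gfact n = ∏ k ∈ Finset.range n, g (k + 1))
    (Z : ℝ → ℝ) (hZ : ∀ β, Z β = ∑' ℓ : ℕ, β ^ ℓ / gfact ℓ)
    (θ : ℝ → ℕ → ℝ) (hθ : ∀ β n, θ β n = (Z β)⁻¹ * β ^ n / gfact n)
    (p q : ℝ) (hp : 1 / 2 < p) (hp1 : p ≤ 1) (hq : q = 1 - p)
    (l r : ℤ) (hlr : l + 2 ≤ r)
    (κ : ℤ → ℝ) (hκ : ∀ x, κ x ∈ Set.Ioc (0 : ℝ) 1)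
    (lam : ℤ → ℝ)
    (hlam : ∀ x : ℤ, lam x =
      (κ r - κ l) / (1 - (q / p) ^ (r - l).toNat) * (q / p) ^ (r - x).toNat +
      (κ l - κ r * (q / p) ^ (r - l).toNat) / (1 - (q / p) ^ (r - l).toNat))
    (hsub : ∀ x : ℤ, l < x → x < r → lam x < κ x)
    -- μ^{κ,l,r}: the product measure on ℕ^{(l,r)∩ℤ} with marginal θ_{λ(x)/κ(x)} at x,
    -- viewed on ℕ^ℤ through its finite-dimensional cylinders
    (μ : Measure (ℤ → ℕ)) (hμprob : IsProbabilityMeasure μ)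
    (hμ : ∀ ζ : ℤ → ℕ,
      μ {η | ∀ x ∈ Finset.Ioo l r, η x = ζ x} =
        ∏ x ∈ Finset.Ioo l r, ENNReal.ofReal (θ (lam x / κ x) (ζ x)))
    -- the test function: bounded, measurable, depending only on the sites in (l,r)
    (f : (ℤ → ℕ) → ℝ) (hf_meas : Measurable f)
    (C : ℝ) (hf_bdd : ∀ η, |f η| ≤ C)
    (hf_local : ∀ η η' : ℤ → ℕ, (∀ x ∈ Finset.Ioo l r, η x = η' x) → f η = f η') :
    ∫ η,
      ((∑ x ∈ Finset.Icc (l + 1) (r - 2),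
          p * κ x * g (η x) * (f (moveConf η x (x + 1)) - f η)) +
       (∑ x ∈ Finset.Icc (l + 1) (r - 2),
          q * κ (x + 1) * g (η (x + 1)) * (f (moveConf η (x + 1) x) - f η)) +
       q * κ (l + 1) * g (η (l + 1)) * (f (removeConf η (l + 1)) - f η) +
       p * κ (r - 1) * g (η (r - 1)) * (f (removeConf η (r - 1)) - f η) +
       p * κ l * (f (addConf η (l + 1)) - f η) +
       q * κ r * (f (addConf η (r - 1)) - f η)) ∂μ = 0 := by
  have hp0 : 0 < p := by linarith
  have hρ0 : 0 ≤ q / p := div_nonneg (by linarith) hp0.le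
  have hρ1 : q / p < 1 := (div_lt_one hp0).2 (by linarith)
  have hN : (q / p) ^ (r - l).toNat < 1 := pow_lt_one₀ hρ0 hρ1 (by omega)
  have hg_nonneg : ∀ n, 0 ≤ g n := fun n => hg0 ▸ hg_mono (Nat.zero_le n)
  have hg_abs : ∀ n, |g n| ≤ 1 := fun n => by
    rw [abs_of_nonneg (hg_nonneg n)]
    exact hg_mono.ge_of_tendsto hg_lim n
  have hg_pos : ∀ n, 0 < g (n + 1) := fun n => hg1.trans_le (hg_mono (by omega))
  have hlam_l : lam l = κ l := by
    rw [hlam]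
    have : 1 - (q / p) ^ (r - l).toNat ≠ 0 := by linarith
    field_simp
    ring
  have hlam_r : lam r = κ r := by
    rw [hlam, sub_self, Int.toNat_zero, pow_zero]
    have : 1 - (q / p) ^ (r - l).toNat ≠ 0 := by linarith
    field_simp
    ring
  obtain ⟨J, hJ⟩ : ∃ J, ∀ x < r, p * lam x - q * lam (x + 1) = J :=
    ⟨_, fun x hx => profile_flux hp0.ne' hlam hx⟩
  have hf : DependsOn f ((Finset.Ioo l r : Finset ℤ) : Set ℤ) := fun η η' h =>
    hf_local η η' fun x hx => h x (Finset.mem_coe.2 hx)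
  have hmem : ∀ x, l + 1 ≤ x → x ≤ r - 1 → x ∈ Finset.Ioo l r := fun x h1 h2 =>
    Finset.mem_Ioo.2 ⟨by omega, by omega⟩
  have hbal : ∀ x ∈ Finset.Ioo l r, ∀ ζ,
      μ.real (cylinderAt (Finset.Ioo l r) (addConf ζ x)) * g (ζ x + 1) =
        lam x / κ x * μ.real (cylinderAt (Finset.Ioo l r) ζ) := by
    intro x hx ζ
    have hx' := Finset.mem_Ioo.1 hx
    have hlam_pos : 0 < lam x := by
      rw [hlam]
      exact profile_pos hρ0 hρ1 (hκ l).1 (hκ r).1 (by omega) (by omega)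
    have hw : ∀ n, θ (lam x / κ x) (n + 1) * g (n + 1) = lam x / κ x * θ (lam x / κ x) n := by
      intro n
      have hfact : gfact n ≠ 0 := by
        rw [hgfact]
        exact Finset.prod_ne_zero_iff.2 fun k _ => (hg_pos k).ne'
      have hsucc : gfact (n + 1) = gfact n * g (n + 1) := by
        rw [hgfact, hgfact, Finset.prod_range_succ]
      have := (hg_pos n).ne'
      rw [hθ, hθ, hsucc, pow_succ, div_mul_eq_mul_div, mul_div_mul_right _ _ this]
      ring
    rw [measureReal_def, measureReal_def, cylinderAt, cylinderAt, hμ, hμ]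
    exact prod_weight_addConf (w := fun z => θ (lam z / κ z)) (β := fun z => lam z / κ z) hx
      hg_nonneg (div_nonneg hlam_pos.le (hκ x).1.le) hw ζ
  obtain ⟨a, ha⟩ : ∃ a : ℤ → ℝ, ∀ x, ∫ η, f (addConf η x) ∂μ = a x := ⟨_, fun _ => rfl⟩
  obtain ⟨e, he⟩ : ∃ e, ∫ η, f η ∂μ = e := ⟨_, rfl⟩
  have hf_int : Integrable f μ := hf.integrable_of_bounded hf_bdd
  have hadd_int : ∀ x ∈ Finset.Ioo l r, Integrable (fun η => f (addConf η x)) μ := fun x hx =>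
    (hf.comp_addConf hx).integrable_of_bounded fun η => hf_bdd _
  have hrate : ∀ (c : ℝ) (x : ℤ), x ∈ Finset.Ioo l r → ∀ F F' : (ℤ → ℕ) → ℝ,
      DependsOn F ((Finset.Ioo l r : Finset ℤ) : Set ℤ) → (∀ η, |F η| ≤ C) →
      (∀ η, F (addConf η x) = F' η) → Integrable F' μ →
      Integrable (fun η => c * κ x * g (η x) * (F η - f η)) μ ∧
      ∫ η, c * κ x * g (η x) * (F η - f η) ∂μ = c * lam x * (∫ η, F' η ∂μ - a x) := by
    intro c x hx F F' hF hFC hFF' hF'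
    have hG : DependsOn (fun η => F η - f η) ((Finset.Ioo l r : Finset ℤ) : Set ℤ) :=
      fun η η' h => by simp only [hF h, hf h]
    obtain ⟨h1, h2⟩ := integral_rate_mul hg0 hg_abs hx (hbal x hx) hG (C := C + C)
      fun η => (abs_sub _ _).trans (add_le_add (hFC η) (hf_bdd η))
    have hfun : (fun η : ℤ → ℕ => c * κ x * g (η x) * (F η - f η)) =
        fun η => c * κ x * (g (η x) * (F η - f η)) := funext fun η => mul_assoc _ _ _
    rw [hfun]
    refine ⟨h1.const_mul _, ?_⟩
    rw [integral_const_mul, h2]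
    simp only [hFF']
    rw [integral_sub hF' (hadd_int x hx), ha]
    have := (hκ x).1.ne'
    field_simp
  have hcreate : ∀ (c : ℝ) (x : ℤ), x ∈ Finset.Ioo l r →
      Integrable (fun η => c * (f (addConf η x) - f η)) μ ∧
      ∫ η, c * (f (addConf η x) - f η) ∂μ = c * (a x - e) := fun c x hx =>
    ⟨((hadd_int x hx).sub hf_int).const_mul c, by
      rw [integral_const_mul, integral_sub (hadd_int x hx) hf_int, ha, he]⟩
  have hmove : ∀ (c : ℝ) (x y : ℤ), x ∈ Finset.Ioo l r → y ∈ Finset.Ioo l r → x ≠ y →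
      Integrable (fun η => c * κ x * g (η x) * (f (moveConf η x y) - f η)) μ ∧
      ∫ η, c * κ x * g (η x) * (f (moveConf η x y) - f η) ∂μ = c * lam x * (a y - a x) :=
    fun c x y hx hy hxy => ha y ▸ hrate c x hx _ _ (hf.comp_moveConf hx hy) (fun η => hf_bdd _)
      (fun η => by rw [moveConf_addConf η hxy]) (hadd_int y hy)
  have hremove : ∀ (c : ℝ) (x : ℤ), x ∈ Finset.Ioo l r →
      Integrable (fun η => c * κ x * g (η x) * (f (removeConf η x) - f η)) μ ∧
      ∫ η, c * κ x * g (η x) * (f (removeConf η x) - f η) ∂μ = c * lam x * (e - a x) :=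
    fun c x hx => he ▸ hrate c x hx _ f (hf.comp_removeConf hx) (fun η => hf_bdd _)
      (fun η => by rw [removeConf_addConf]) hf_int
  have hright : ∀ x ∈ Finset.Icc (l + 1) (r - 2), _ := fun x hx =>
    have hx' := Finset.mem_Icc.1 hx
    hmove p x (x + 1) (hmem _ (by omega) (by omega)) (hmem _ (by omega) (by omega)) (by omega)
  have hleft : ∀ x ∈ Finset.Icc (l + 1) (r - 2), _ := fun x hx =>
    have hx' := Finset.mem_Icc.1 hx
    hmove q (x + 1) x (hmem _ (by omega) (by omega)) (hmem _ (by omega) (by omega)) (by omega)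
  have i1 := integrable_finsetSum _ fun x hx => (hright x hx).1
  have i2 := integrable_finsetSum _ fun x hx => (hleft x hx).1
  have hl1 := hmem (l + 1) (by omega) (by omega)
  have hr1 := hmem (r - 1) (by omega) (by omega)
  have h3 := hremove q (l + 1) hl1
  have h4 := hremove p (r - 1) hr1
  have h5 := hcreate (p * κ l) (l + 1) hl1
  have h6 := hcreate (q * κ r) (r - 1) hr1
  rw [integral_add ((((i1.fun_add i2).fun_add h3.1).fun_add h4.1).fun_add h5.1) h6.1,
    integral_add (((i1.fun_add i2).fun_add h3.1).fun_add h4.1) h5.1,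
    integral_add ((i1.fun_add i2).fun_add h3.1) h4.1, integral_add (i1.fun_add i2) h3.1,
    integral_add i1 i2, integral_finsetSum _ fun x hx => (hright x hx).1,
    integral_finsetSum _ fun x hx => (hleft x hx).1,
    Finset.sum_congr rfl fun x hx => (hright x hx).2,
    Finset.sum_congr rfl fun x hx => (hleft x hx).2, h3.2, h4.2, h5.2, h6.2,
    ← Finset.sum_add_distrib]
  have hsum : ∑ x ∈ Finset.Icc (l + 1) (r - 2),
      (p * lam x * (a (x + 1) - a x) + q * lam (x + 1) * (a x - a (x + 1))) =
        J * (a (r - 1) - a (l + 1)) := by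
    have htel := sum_Icc_int_sub a (l + 1) (r - l - 2).toNat
    rw [show l + 1 + ((r - l - 2).toNat : ℤ) = r - 1 by omega,
      show r - 1 - 1 = r - 2 by ring] at htel
    rw [← htel, Finset.mul_sum]
    refine Finset.sum_congr rfl fun x hx => ?_
    rw [← hJ x (by have := Finset.mem_Icc.1 hx; omega)]
    ring
  have hJl := hJ l (by omega)
  have hJr := hJ (r - 1) (by omega)
  rw [sub_add_cancel] at hJr
  rw [hsum, ← hlam_l, ← hlam_r]
  linear_combination (a (l + 1) - e) * hJl + (e - a (r - 1)) * hJr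
end

section
/- Let α : ℤ → (0,1] be an environment, p ∈ (1/2,1], q := 1−p, and 0 ≤ β < inf_{x∈ℤ} α(x). Then the product measure μ^α_β is invariant for the zero-range generator: for every bounded measurable f : ℕ^ℤ → ℝ depending on only finitely many coordinates, ∫ L^α f dμ^α_β = 0, where L^α f(η) := Σ_{x∈ℤ} α(x) g(η(x)) [ p (f(η^{x,x+1}) − f(η)) + q (f(η^{x,x−1}) − f(η)) ] (the sum has finitely many nonzero terms since f is local). -/
open Filter Set MeasureTheory

/-- The configuration obtained from `η` by adding a particle at `x`. -/
def addParticle (η : ℤ → ℕ) (x : ℤ) : ℤ → ℕ :=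
  fun z => if z = x then η x + 1 else η z

lemma measurable_addParticle (x : ℤ) : Measurable fun η : ℤ → ℕ => addParticle η x := by
  refine measurable_pi_iff.2 fun z => ?_
  unfold addParticle
  split_ifs
  · exact (measurable_pi_apply x).add_const 1
  · exact measurable_pi_apply z

lemma measurable_moveConf (x y : ℤ) : Measurable fun η : ℤ → ℕ => moveConf η x y := by
  refine measurable_pi_iff.2 fun z => ?_
  unfold moveConf
  split_ifs
  · exact (measurable_of_countable fun n : ℕ => n - 1).comp (measurable_pi_apply x)
  · exact (measurable_pi_apply y).add_const 1
  · exact measurable_pi_apply z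

lemma moveConf_addParticle {x y : ℤ} (hxy : x ≠ y) (η : ℤ → ℕ) :
    moveConf (addParticle η x) x y = addParticle η y := by
  funext z
  simp only [moveConf, addParticle]
  split_ifs <;> simp_all

/-- The cylinder sets of `ℤ → ℕ` whose base contains the site `x`. -/
def cylindersThrough (x : ℤ) : Set (Set (ℤ → ℕ)) :=
  {s | ∃ (S : Finset ℤ) (ζ : ℤ → ℕ), x ∈ S ∧ s = {η | ∀ z ∈ S, η z = ζ z}}

lemma measurableSet_cylinder (S : Finset ℤ) (ζ : ℤ → ℕ) :
    MeasurableSet {η : ℤ → ℕ | ∀ z ∈ S, η z = ζ z} := by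
  have h : {η : ℤ → ℕ | ∀ z ∈ S, η z = ζ z} = ⋂ z ∈ S, (fun η : ℤ → ℕ => η z) ⁻¹' {ζ z} := by
    ext η; simp
  rw [h]
  exact Finset.measurableSet_biInter S fun z _ =>
    measurable_pi_apply z (measurableSet_singleton _)

lemma isPiSystem_cylindersThrough (x : ℤ) : IsPiSystem (cylindersThrough x) := by
  rintro _ ⟨S, ζ, hS, rfl⟩ _ ⟨S', ζ', hS', rfl⟩ ⟨ξ, hξ, hξ'⟩
  refine ⟨S ∪ S', ξ, Finset.mem_union_left _ hS, ?_⟩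
  ext η
  simp only [mem_inter_iff, mem_ofPred_eq, Finset.mem_union] at hξ hξ' ⊢
  constructor
  · rintro ⟨h, h'⟩ z (hz | hz)
    · rw [h z hz, hξ z hz]
    · rw [h' z hz, hξ' z hz]
  · intro h
    exact ⟨fun z hz => (h z (Or.inl hz)).trans (hξ z hz),
      fun z hz => (h z (Or.inr hz)).trans (hξ' z hz)⟩

lemma generateFrom_cylindersThrough (x : ℤ) :
    (MeasurableSpace.pi : MeasurableSpace (ℤ → ℕ)) =
      MeasurableSpace.generateFrom (cylindersThrough x) := by
  apply le_antisymm
  · refine iSup_le fun y => ?_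
    have hy : Measurable[MeasurableSpace.generateFrom (cylindersThrough x)]
        (fun η : ℤ → ℕ => η y) := by
      refine @measurable_to_countable' ℕ (ℤ → ℕ) _ _
        (MeasurableSpace.generateFrom (cylindersThrough x)) _ fun n => ?_
      have h : (fun η : ℤ → ℕ => η y) ⁻¹' {n} =
          ⋃ m : ℕ, {η | ∀ z ∈ ({x, y} : Finset ℤ), η z = Function.update (fun _ => m) y n z} := by
        ext η
        by_cases hxy : x = y
        · simp [hxy]
        · simp [Function.update_of_ne hxy]
      rw [h]
      exact MeasurableSet.iUnion fun m =>
        MeasurableSpace.measurableSet_generateFrom ⟨_, _, by simp, rfl⟩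
    exact hy.comap_le
  · refine MeasurableSpace.generateFrom_le ?_
    rintro _ ⟨S, ζ, -, rfl⟩
    exact measurableSet_cylinder S ζ

/-- If the law at site `x` satisfies the detailed-balance recursion `c (n + 1) w (n + 1) = b w n`,
then weighting the product measure by `c (η x)` amounts to adding a particle at `x`. -/
lemma withDensity_eq_smul_map_addParticle {μ : Measure (ℤ → ℕ)} [IsFiniteMeasure μ]
    (w : ℤ → ℕ → ENNReal)
    (hμ : ∀ (S : Finset ℤ) (ζ : ℤ → ℕ), μ {η | ∀ z ∈ S, η z = ζ z} = ∏ z ∈ S, w z (ζ z))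
    (x : ℤ) (c : ℕ → ENNReal) (b : ENNReal) (hc0 : c 0 = 0) (hc : ∀ n, c n ≠ ⊤)
    (hrec : ∀ n, c (n + 1) * w x (n + 1) = b * w x n) :
    μ.withDensity (fun η => c (η x)) = b • μ.map (fun η => addParticle η x) := by
  have hval : ∀ (S : Finset ℤ) (ζ : ℤ → ℕ), x ∈ S →
      μ.withDensity (fun η => c (η x)) {η | ∀ z ∈ S, η z = ζ z} =
        c (ζ x) * μ {η | ∀ z ∈ S, η z = ζ z} := by
    intro S ζ hx
    rw [withDensity_apply _ (measurableSet_cylinder S ζ),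
      setLIntegral_congr_fun (g := fun _ => c (ζ x)) (measurableSet_cylinder S ζ)
        (fun η hη => by simp only [hη x hx]), setLIntegral_const]
  refine Measure.ext_of_generateFrom_of_cover_subset
    (T := range fun n : ℕ => {η : ℤ → ℕ | ∀ z ∈ ({x} : Finset ℤ), η z = (fun _ => n) z})
    (generateFrom_cylindersThrough x) (isPiSystem_cylindersThrough x) ?_ (countable_range _) ?_ ?_ ?_
  · rintro _ ⟨n, rfl⟩
    exact ⟨{x}, fun _ => n, by simp, rfl⟩
  · ext η
    simp
  · rintro _ ⟨n, rfl⟩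
    rw [hval _ _ (Finset.mem_singleton_self x)]
    exact ENNReal.mul_ne_top (hc _) (measure_ne_top μ _)
  · rintro _ ⟨S, ζ, hx, rfl⟩
    rw [hval S ζ hx, Measure.smul_apply,
      Measure.map_apply (measurable_addParticle x) (measurableSet_cylinder S ζ), smul_eq_mul]
    rcases hζ : ζ x with _ | n
    · have : (fun η : ℤ → ℕ => addParticle η x) ⁻¹' {η | ∀ z ∈ S, η z = ζ z} = ∅ := by
        ext η
        simp only [mem_preimage, mem_ofPred_eq, mem_empty_iff_false, iff_false]
        intro h
        have := h x hx
        simp [addParticle, hζ] at this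
      rw [this, hc0]
      simp
    · have : (fun η : ℤ → ℕ => addParticle η x) ⁻¹' {η | ∀ z ∈ S, η z = ζ z} =
          {η | ∀ z ∈ S, η z = Function.update ζ x n z} := by
        ext η
        simp only [mem_preimage, mem_ofPred_eq]
        refine forall₂_congr fun z _ => ?_
        by_cases hz : z = x
        · subst hz; simp [addParticle, hζ]
        · simp [addParticle, hz]
      rw [this, hμ, hμ, ← Finset.mul_prod_erase S _ hx, ← Finset.mul_prod_erase S _ hx,
        ← mul_assoc, ← mul_assoc, hζ, hrec, Function.update_self]
      congr 1
      refine Finset.prod_congr rfl fun z hz => ?_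
      rw [Function.update_of_ne (Finset.ne_of_mem_erase hz)]

/-- A finitely supported perturbation of a constant has vanishing asymmetric discrete Laplacian
sum. -/
lemma sum_asymmetric_laplacian_eq_zero (A : ℤ → ℝ) (a p q : ℝ) (S T : Finset ℤ)
    (hA : ∀ x ∉ S, A x = a)
    (hT : ∀ x ∉ T, x ∉ S ∧ x + 1 ∉ S ∧ x - 1 ∉ S) :
    ∑ x ∈ T, (p * (A (x + 1) - A x) + q * (A (x - 1) - A x)) = 0 := by
  have hB : HasSum (fun x => A x - a) (∑ x ∈ S, (A x - a)) :=
    hasSum_sum_of_ne_finset_zero fun x hx => by rw [hA x hx, sub_self]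
  have hB₁ := (Equiv.addRight (1 : ℤ)).hasSum_iff.2 hB
  have hB₂ := (Equiv.subRight (1 : ℤ)).hasSum_iff.2 hB
  have h := ((hB₁.sub hB).mul_left p).add ((hB₂.sub hB).mul_left q)
  have h_sum : HasSum (fun x => p * (A (x + 1) - A x) + q * (A (x - 1) - A x))
      (∑ x ∈ T, (p * (A (x + 1) - A x) + q * (A (x - 1) - A x))) :=
    hasSum_sum_of_ne_finset_zero fun x hx => by
      obtain ⟨h₀, h₁, h₂⟩ := hT x hx
      rw [hA _ h₀, hA _ h₁, hA _ h₂]; ring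
  simp only [sub_self, mul_zero, add_zero, Function.comp_apply, Equiv.coe_addRight,
    Equiv.subRight_apply, sub_sub_sub_cancel_right] at h
  exact h_sum.unique h

/-- For an environment `α : ℤ → (0,1]` and `0 ≤ β < inf_x α(x)`,
the product measure `μ^α_β` is invariant for the zero-range generator `L^α`:
for every bounded measurable local `f`, `∫ L^α f dμ^α_β = 0`. -/
theorem statement11
    (g : ℕ → ℝ) (hg_mono : Monotone g) (hg0 : g 0 = 0) (hg1 : 0 < g 1)
    (hg_lim : Filter.Tendsto g Filter.atTop (nhds 1))
    (hg_sup : (⨆ n, g n) = 1)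
    (gfact : ℕ → ℝ) (hgfact : ∀ n, gfact n = ∏ k ∈ Finset.range n, g (k + 1))
    (Z : ℝ → ℝ) (hZ : ∀ β, Z β = ∑' ℓ : ℕ, β ^ ℓ / gfact ℓ)
    (θ : ℝ → ℕ → ℝ) (hθ : ∀ β n, θ β n = (Z β)⁻¹ * β ^ n / gfact n)
    (p q : ℝ) (hp : 1 / 2 < p) (hp1 : p ≤ 1) (hq : q = 1 - p)
    (α : ℤ → ℝ) (hα : ∀ x, α x ∈ Set.Ioc (0 : ℝ) 1)
    (β : ℝ) (hβ0 : 0 ≤ β) (hβ : β < ⨅ x : ℤ, α x)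
    -- μ^α_β: the product measure with marginal θ_{β/α(x)} at site x,
    -- characterized by its finite-dimensional cylinders
    (μ : Measure (ℤ → ℕ)) (hμprob : IsProbabilityMeasure μ)
    (hμ : ∀ (S : Finset ℤ) (ζ : ℤ → ℕ),
      μ {η | ∀ x ∈ S, η x = ζ x} = ∏ x ∈ S, ENNReal.ofReal (θ (β / α x) (ζ x)))
    -- the test function: bounded, measurable, local
    (f : (ℤ → ℕ) → ℝ) (hf_meas : Measurable f)
    (C : ℝ) (hf_bdd : ∀ η, |f η| ≤ C)
    (S : Finset ℤ)
    (hf_local : ∀ η η' : ℤ → ℕ, (∀ x ∈ S, η x = η' x) → f η = f η') :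
    ∫ η, (∑' x : ℤ, α x * g (η x) *
        (p * (f (moveConf η x (x + 1)) - f η) +
         q * (f (moveConf η x (x - 1)) - f η))) ∂μ = 0 := by
  have hg_pos : ∀ n, 0 < g (n + 1) := fun n => hg1.trans_le (hg_mono (by omega))
  have hg_nonneg : ∀ n, 0 ≤ g n := fun n => hg0 ▸ hg_mono (Nat.zero_le n)
  have hg_le : ∀ n, g n ≤ 1 := fun n => hg_mono.ge_of_tendsto hg_lim n
  have hrate : ∀ x n, 0 ≤ α x * g n := fun x n => mul_nonneg (hα x).1.le (hg_nonneg n)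
  have hθ_rec : ∀ x n, α x * g (n + 1) * θ (β / α x) (n + 1) = β * θ (β / α x) n := by
    intro x n
    have h₁ := (hg_pos n).ne'
    have h₂ := (hα x).1.ne'
    have h₃ : gfact (n + 1) = gfact n * g (n + 1) := by
      rw [hgfact, hgfact, Finset.prod_range_succ]
    have h₄ : gfact n ≠ 0 := by
      rw [hgfact]; exact Finset.prod_ne_zero_iff.2 fun k _ => (hg_pos k).ne'
    rw [hθ, hθ, h₃, pow_succ]
    generalize (Z (β / α x))⁻¹ = c
    generalize (β / α x) ^ n = d
    field_simp
  have hdensity : ∀ x, μ.withDensity (fun η => ENNReal.ofReal (α x * g (η x))) =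
      ENNReal.ofReal β • μ.map (fun η => addParticle η x) := by
    intro x
    refine withDensity_eq_smul_map_addParticle (fun z n => ENNReal.ofReal (θ (β / α z) n)) hμ x
      (fun n => ENNReal.ofReal (α x * g n)) _ (by simp [hg0]) (fun n => ENNReal.ofReal_ne_top)
      fun n => ?_
    rw [← ENNReal.ofReal_mul (hrate x _), hθ_rec, ENNReal.ofReal_mul hβ0]
  have hrate_meas : ∀ x, Measurable fun η : ℤ → ℕ => α x * g (η x) := fun x =>
    (measurable_of_countable fun n : ℕ => α x * g n).comp (measurable_pi_apply x)
  have hchange : ∀ x (h : (ℤ → ℕ) → ℝ), Measurable h →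
      ∫ η, α x * g (η x) * h η ∂μ = β * ∫ η, h (addParticle η x) ∂μ := by
    intro x h hh
    have h₁ := integral_withDensity_eq_integral_toReal_smul (μ := μ)
      (hrate_meas x).ennreal_ofReal (ae_of_all _ fun η => ENNReal.ofReal_lt_top) h
    rw [hdensity, integral_smul_measure,
      integral_map (measurable_addParticle x).aemeasurable hh.aestronglyMeasurable,
      ENNReal.toReal_ofReal hβ0] at h₁
    simp only [smul_eq_mul, ENNReal.toReal_ofReal (hrate x _)] at h₁
    exact h₁.symm
  have hint : ∀ x (h : (ℤ → ℕ) → ℝ), Measurable h → (∀ η, |h η| ≤ C) →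
      Integrable (fun η => α x * g (η x) * h η) μ := by
    intro x h hh hC
    refine Integrable.of_bound ((hrate_meas x).mul hh).aestronglyMeasurable C
      (ae_of_all _ fun η => ?_)
    rw [Real.norm_eq_abs, abs_mul, abs_of_nonneg (hrate x _)]
    have : α x * g (η x) ≤ 1 := mul_le_one₀ (hα x).2 (hg_nonneg _) (hg_le _)
    exact (mul_le_of_le_one_left (abs_nonneg _) this).trans (hC η)
  set T : Finset ℤ := S ∪ S.image (· - 1) ∪ S.image (· + 1) with hT_def
  have hT : ∀ x ∉ T, x ∉ S ∧ x + 1 ∉ S ∧ x - 1 ∉ S := by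
    intro x hx
    simp only [hT_def, Finset.mem_union, Finset.mem_image, not_or, not_exists, not_and] at hx
    exact ⟨hx.1.1, fun h => hx.1.2 _ h (by ring), fun h => hx.2 _ h (by ring)⟩
  have hmove : ∀ x y η, x ∉ S → y ∉ S → f (moveConf η x y) = f η := by
    intro x y η hx hy
    refine hf_local _ _ fun z hz => ?_
    have h₁ : z ≠ x := fun h => hx (h ▸ hz)
    have h₂ : z ≠ y := fun h => hy (h ▸ hz)
    simp [moveConf, h₁, h₂]
  have hgen : ∀ η : ℤ → ℕ, (∑' x : ℤ, α x * g (η x) *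
        (p * (f (moveConf η x (x + 1)) - f η) + q * (f (moveConf η x (x - 1)) - f η))) =
      ∑ x ∈ T, (p * (α x * g (η x) * f (moveConf η x (x + 1)) - α x * g (η x) * f η) +
        q * (α x * g (η x) * f (moveConf η x (x - 1)) - α x * g (η x) * f η)) := by
    intro η
    rw [tsum_eq_sum (s := T)]
    · exact Finset.sum_congr rfl fun x _ => by ring
    · intro x hx
      obtain ⟨h₀, h₁, h₂⟩ := hT x hx
      rw [hmove _ _ _ h₀ h₁, hmove _ _ _ h₀ h₂]
      ring
  simp_rw [hgen]
  have hf_move : ∀ x y, Measurable fun η => f (moveConf η x y) := fun x y =>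
    hf_meas.comp (measurable_moveConf x y)
  have hint_f := fun x => hint x f hf_meas hf_bdd
  have hint_move := fun x y => hint x (fun η => f (moveConf η x y)) (hf_move x y)
    fun η => hf_bdd _
  have hjump : ∀ x y, x ≠ y →
      ∫ η, α x * g (η x) * f (moveConf η x y) ∂μ = β * ∫ η, f (addParticle η y) ∂μ := by
    intro x y hxy
    rw [hchange x _ (hf_move x y)]
    simp_rw [moveConf_addParticle hxy]
  have hint_diff : ∀ x y r, Integrable
      (fun η => r * (α x * g (η x) * f (moveConf η x y) - α x * g (η x) * f η)) μ :=
    fun x y r => ((hint_move x y).sub (hint_f x)).const_mul r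
  refine (integral_finsetSum _ fun x _ =>
    (hint_diff x (x + 1) p).add (hint_diff x (x - 1) q)).trans ?_
  refine (Finset.sum_congr rfl fun x _ => ?_).trans (sum_asymmetric_laplacian_eq_zero
    (fun x => β * ∫ η, f (addParticle η x) ∂μ) (β * ∫ η, f η ∂μ) p q S T ?_ hT)
  · rw [integral_add' (hint_diff x _ p) (hint_diff x _ q), integral_const_mul, integral_const_mul,
      integral_sub (hint_move x _) (hint_f x), integral_sub (hint_move x _) (hint_f x),
      hjump x (x + 1) (by omega), hjump x (x - 1) (by omega), hchange x f hf_meas]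
  · intro x hx
    have : ∀ η, f (addParticle η x) = f η := fun η => hf_local _ _ fun z hz => by
      have h : z ≠ x := fun h => hx (h ▸ hz)
      simp [addParticle, h]
    simp_rw [this]
end

section
/- Suppose the environment α : ℤ → [0,1] satisfies Assumption 1 with limit Q0, and let β ∈ [0,1) satisfy β < α(x) for every x ∈ ℤ, β < inf_{x∈ℤ} α(x), and β < inf supp Q0. Let η be a random element of ℕ^ℤ with law μ^α_β. Then, in probability as n → ∞, (n+1)^{-1} Σ_{x=0}^n η(x) → R̄^{Q0}(β) and (n+1)^{-1} Σ_{x=0}^n η(−x) → R̄^{Q0}(β); that is, for every δ > 0 the probability that |(n+1)^{-1} Σ_{x=0}^n η(±x) − R̄^{Q0}(β)| > δ tends to 0. -/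
open Filter Set MeasureTheory ProbabilityTheory

lemma summable_pow_mul_pow_div_prod {g : ℕ → ℝ} (hpos : ∀ n, 0 < g (n + 1))
    (hlim : Tendsto g atTop (nhds 1)) (k : ℕ) {r : ℝ} (hr0 : 0 < r) (hr1 : r < 1) :
    Summable fun n : ℕ => (n : ℝ) ^ k * (r ^ n / ∏ j ∈ Finset.range n, g (j + 1)) := by
  have hprod : ∀ n, 0 < ∏ j ∈ Finset.range n, g (j + 1) := fun n =>
    Finset.prod_pos fun j _ => hpos j
  refine summable_of_ratio_test_tendsto_lt_one hr1 ?_ ?_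
  · filter_upwards [eventually_gt_atTop 0] with n hn
    have := hprod n
    positivity
  · have h1 : Tendsto (fun n : ℕ => (1 + 1 / (n : ℝ)) ^ k * (r / g (n + 1))) atTop (nhds r) := by
      have h2 : Tendsto (fun n : ℕ => 1 + 1 / (n : ℝ)) atTop (nhds (1 + 0)) :=
        tendsto_const_nhds.add tendsto_one_div_atTop_nhds_zero_nat
      have h3 : Tendsto (fun n : ℕ => r / g (n + 1)) atTop (nhds (r / 1)) :=
        tendsto_const_nhds.div ((tendsto_add_atTop_iff_nat 1).2 hlim) one_ne_zero
      simpa using (h2.pow k).mul h3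
    refine h1.congr' ?_
    filter_upwards [eventually_gt_atTop 0] with n hn
    have hp := hprod n
    have hg := hpos n
    have hn' : (0 : ℝ) < n := by exact_mod_cast hn
    rw [Real.norm_of_nonneg (by have := hprod (n + 1); positivity),
      Real.norm_of_nonneg (by positivity), Finset.prod_range_succ]
    have h4 : (1 + 1 / (n : ℝ)) = (n + 1) / n := by field_simp
    rw [h4, div_pow]
    push_cast
    field_simp
    ring

lemma continuousOn_tsum_mul_pow_div {c w : ℕ → ℝ} (hc : ∀ n, 0 ≤ c n) (hw : ∀ n, 0 < w n) {r : ℝ}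
    (hs : Summable fun n : ℕ => c n * (r ^ n / w n)) :
    ContinuousOn (fun t => ∑' n : ℕ, c n * (t ^ n / w n)) (Icc 0 r) := by
  refine continuousOn_tsum (fun n => by fun_prop) hs fun n t ht => ?_
  have h0 := hc n
  have h1 := hw n
  have ht0 := ht.1
  rw [Real.norm_of_nonneg (by positivity)]
  have := ht.2
  gcongr

lemma integrable_comp_and_integral_eq_tsum {Ω : Type*} [MeasurableSpace Ω] {μ : Measure Ω}
    {X : Ω → ℕ} (hX : Measurable X) {p : ℕ → ℝ} (hp : ∀ n, 0 ≤ p n)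
    (hμ : ∀ n, μ {ω | X ω = n} = ENNReal.ofReal (p n)) {h : ℕ → ℝ} (hh : ∀ n, 0 ≤ h n)
    (hs : Summable fun n => h n * p n) :
    Integrable (fun ω => h (X ω)) μ ∧ ∫ ω, h (X ω) ∂μ = ∑' n, h n * p n := by
  have hmap : ∀ n, μ.map X {n} = ENNReal.ofReal (p n) := fun n => by
    rw [Measure.map_apply hX (measurableSet_singleton n), ← hμ n]
    rfl
  have hmeas : Measurable h := measurable_of_countable h
  have hint : Integrable h (μ.map X) := by
    refine ⟨hmeas.aestronglyMeasurable, ?_⟩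
    rw [hasFiniteIntegral_iff_ofReal (Eventually.of_forall hh), lintegral_countable']
    have : ∀ n, ENNReal.ofReal (h n) * μ.map X {n} = ENNReal.ofReal (h n * p n) := fun n => by
      rw [hmap, ENNReal.ofReal_mul (hh n)]
    simp_rw [this]
    exact hs.tsum_ofReal_lt_top
  refine ⟨hint.comp_measurable hX, ?_⟩
  rw [← integral_map hX.aemeasurable hmeas.aestronglyMeasurable, integral_countable hint]
  refine tsum_congr fun n => ?_
  rw [measureReal_def, hmap, ENNReal.toReal_ofReal (hp n), smul_eq_mul, mul_comm]

lemma indepFun_of_measure_eq_mul {Ω : Type*} [MeasurableSpace Ω] {μ : Measure Ω}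
    [IsProbabilityMeasure μ] {X Y : Ω → ℕ} (hX : Measurable X) (hY : Measurable Y)
    (h : ∀ m n, μ {ω | X ω = m ∧ Y ω = n} = μ {ω | X ω = m} * μ {ω | Y ω = n}) :
    IndepFun X Y μ := by
  rw [indepFun_iff_map_prod_eq_prod_map_map hX.aemeasurable hY.aemeasurable]
  refine Measure.ext_of_singleton fun ⟨m, n⟩ => ?_
  rw [Measure.map_apply (hX.prodMk hY) (measurableSet_singleton _), ← singleton_prod_singleton,
    Measure.prod_prod, Measure.map_apply hX (measurableSet_singleton _),
    Measure.map_apply hY (measurableSet_singleton _)]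
  exact h m n

lemma tendsto_measure_lt_abs_average_sub {Ω : Type*} [MeasurableSpace Ω] {μ : Measure Ω}
    [IsProbabilityMeasure μ] {X : ℕ → Ω → ℝ} (hL2 : ∀ i, MemLp (X i) 2 μ)
    (hindep : Pairwise fun i j => IndepFun (X i) (X j) μ) {C : ℝ} (hC : ∀ i, Var[X i; μ] ≤ C)
    {m : ℝ} (hm : Tendsto (fun n : ℕ => ((n : ℝ) + 1)⁻¹ * ∑ i ∈ Finset.range (n + 1), ∫ ω, X i ω ∂μ)
      atTop (nhds m)) {δ : ℝ} (hδ : 0 < δ) :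
    Tendsto (fun n : ℕ => μ {ω | δ < |((n : ℝ) + 1)⁻¹ * (∑ i ∈ Finset.range (n + 1), X i ω) - m|})
      atTop (nhds 0) := by
  have hlim : Tendsto (fun n : ℕ => ENNReal.ofReal (C / (δ / 2) ^ 2 * (1 / ((n : ℝ) + 1))))
      atTop (nhds 0) := by
    have := tendsto_one_div_add_atTop_nhds_zero_nat (𝕜 := ℝ) |>.const_mul (C / (δ / 2) ^ 2)
    simpa using ENNReal.tendsto_ofReal this
  refine tendsto_of_tendsto_of_tendsto_of_le_of_le' tendsto_const_nhds hlim
    (Eventually.of_forall fun _ => zero_le) ?_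
  filter_upwards [Metric.tendsto_nhds.1 hm (δ / 2) (half_pos hδ)] with n hn
  have hn0 : (0 : ℝ) < n + 1 := by positivity
  set S : Ω → ℝ := ∑ i ∈ Finset.range (n + 1), X i with hS
  have hSL2 : MemLp S 2 μ := memLp_finsetSum' _ fun i _ => hL2 i
  have hES : ∫ ω, S ω ∂μ = ∑ i ∈ Finset.range (n + 1), ∫ ω, X i ω ∂μ := by
    simp only [hS, Finset.sum_apply]
    exact integral_finsetSum _ fun i _ => (hL2 i).integrable one_le_two
  have hVar : Var[S; μ] ≤ (n + 1) * C := by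
    rw [hS, IndepFun.variance_sum (fun i _ => hL2 i) fun i _ j _ hij => hindep hij]
    refine (Finset.sum_le_sum fun i _ => hC i).trans_eq ?_
    simp
  have hsub : {ω | δ < |((n : ℝ) + 1)⁻¹ * (∑ i ∈ Finset.range (n + 1), X i ω) - m|} ⊆
      {ω | δ / 2 * (n + 1) ≤ |S ω - ∫ ω, S ω ∂μ|} := by
    intro ω hω
    simp only [mem_ofPred_eq] at hω ⊢
    rw [Real.dist_eq, ← hES] at hn
    have hSω : ∑ i ∈ Finset.range (n + 1), X i ω = S ω := by simp [hS]
    rw [hSω] at hω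
    have h1 := abs_sub_le (((n : ℝ) + 1)⁻¹ * S ω) (((n : ℝ) + 1)⁻¹ * ∫ ω, S ω ∂μ) m
    rw [← mul_sub, abs_mul, abs_of_pos (inv_pos.2 hn0)] at h1
    have h2 : δ / 2 ≤ ((n : ℝ) + 1)⁻¹ * |S ω - ∫ ω, S ω ∂μ| := by linarith
    rwa [le_inv_mul_iff₀ hn0, mul_comm] at h2
  refine (measure_mono hsub).trans
    ((meas_ge_le_variance_div_sq hSL2 (by positivity)).trans (ENNReal.ofReal_le_ofReal ?_))
  calc Var[S; μ] / (δ / 2 * (n + 1)) ^ 2 ≤ (n + 1) * C / (δ / 2 * (n + 1)) ^ 2 := by gcongr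
    _ = C / (δ / 2) ^ 2 * (1 / ((n : ℝ) + 1)) := by field_simp

lemma ae_le_of_tendsto_average {a : ℕ → ℝ} {a₀ : ℝ} (ha : ∀ n, a₀ ≤ a n) {Q : Measure ℝ}
    [IsProbabilityMeasure Q] (hQ : Q (Icc (0 : ℝ) 1)ᶜ = 0)
    (hlim : ∀ φ : ℝ → ℝ, Continuous φ →
      Tendsto (fun n : ℕ => ((n : ℝ) + 1)⁻¹ * ∑ x ∈ Finset.range (n + 1), φ (a x))
        atTop (nhds (∫ y, φ y ∂Q))) :
    ∀ᵐ y ∂Q, a₀ ≤ y := by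
  have hcont : Continuous fun y : ℝ => max 0 (a₀ - y) := by fun_prop
  have h0 : ∫ y, max 0 (a₀ - y) ∂Q = 0 := by
    refine tendsto_nhds_unique (hlim _ hcont) (tendsto_const_nhds.congr fun n => ?_)
    rw [Finset.sum_eq_zero fun x _ => max_eq_left (by linarith [ha x]), mul_zero]
  have hae : ∀ᵐ y ∂Q, y ∈ Icc (0 : ℝ) 1 := hQ
  have hint : Integrable (fun y : ℝ => max 0 (a₀ - y)) Q := by
    refine Integrable.of_bound hcont.aestronglyMeasurable |a₀| ?_
    filter_upwards [hae] with y hy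
    rw [Real.norm_of_nonneg (le_max_left _ _)]
    exact max_le (abs_nonneg _) (by linarith [le_abs_self a₀, hy.1])
  have := (integral_eq_zero_iff_of_nonneg (fun y => le_max_left _ _) hint).1 h0
  filter_upwards [this] with y hy
  have h1 : max 0 (a₀ - y) = 0 := hy
  linarith [le_max_right 0 (a₀ - y)]

/-- Under Assumption 1 with limit `Q0`, for subcritical
`β` (namely `β ∈ [0,1)`, `β < α(x)` for all `x`, `β < inf_x α(x)` and
`β < inf supp Q0`), the empirical mean of a configuration `η ~ μ^α_β` over
`{0,…,n}` and over `{−n,…,0}` converges in probability to `R̄^{Q0}(β)`. -/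
theorem statement12
    (g : ℕ → ℝ) (hg_mono : Monotone g) (hg0 : g 0 = 0) (hg1 : 0 < g 1)
    (hg_lim : Filter.Tendsto g Filter.atTop (nhds 1))
    (hg_sup : (⨆ n, g n) = 1)
    (gfact : ℕ → ℝ) (hgfact : ∀ n, gfact n = ∏ k ∈ Finset.range n, g (k + 1))
    (Z : ℝ → ℝ) (hZ : ∀ β, Z β = ∑' ℓ : ℕ, β ^ ℓ / gfact ℓ)
    (θ : ℝ → ℕ → ℝ) (hθ : ∀ β n, θ β n = (Z β)⁻¹ * β ^ n / gfact n)
    (R : ℝ → ℝ) (hR : ∀ β, R β = ∑' n : ℕ, (n : ℝ) * θ β n)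
    -- the environment satisfies Assumption 1 with limit Q0
    (α : ℤ → ℝ) (hα : ∀ x, α x ∈ Set.Icc (0 : ℝ) 1)
    (Q0 : Measure ℝ) (hQ0prob : IsProbabilityMeasure Q0)
    (hQ0supp : Q0 (Set.Icc (0 : ℝ) 1)ᶜ = 0)
    (hright : ∀ φ : ℝ → ℝ, Continuous φ →
      Tendsto (fun n : ℕ => ((n : ℝ) + 1)⁻¹ * ∑ x ∈ Finset.range (n + 1), φ (α (x : ℤ)))
        atTop (nhds (∫ a, φ a ∂Q0)))
    (hleft : ∀ φ : ℝ → ℝ, Continuous φ →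
      Tendsto (fun n : ℕ => ((n : ℝ) + 1)⁻¹ * ∑ x ∈ Finset.range (n + 1), φ (α (-(x : ℤ))))
        atTop (nhds (∫ a, φ a ∂Q0)))
    -- the parameter β
    (β : ℝ) (hβ0 : 0 ≤ β) (hβ1 : β < 1)
    (hβα : ∀ x : ℤ, β < α x)
    (hβinf : β < ⨅ x : ℤ, α x)
    (hβsupp : β < sInf {a : ℝ | ∀ U ∈ nhds a, 0 < Q0 U})
    -- η has law μ^α_β, the product measure with marginal θ_{β/α(x)} at site x
    (μ : Measure (ℤ → ℕ)) (hμprob : IsProbabilityMeasure μ)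
    (hμ : ∀ (S : Finset ℤ) (ζ : ℤ → ℕ),
      μ {η | ∀ x ∈ S, η x = ζ x} = ∏ x ∈ S, ENNReal.ofReal (θ (β / α x) (ζ x))) :
    ∀ δ > (0 : ℝ),
      Tendsto (fun n : ℕ => μ {η : ℤ → ℕ |
          δ < |((n : ℝ) + 1)⁻¹ * (∑ x ∈ Finset.range (n + 1), (η (x : ℤ) : ℝ)) -
               ∫ a, R (β / a) ∂Q0|}) atTop (nhds 0) ∧
      Tendsto (fun n : ℕ => μ {η : ℤ → ℕ |
          δ < |((n : ℝ) + 1)⁻¹ * (∑ x ∈ Finset.range (n + 1), (η (-(x : ℤ)) : ℝ)) -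
               ∫ a, R (β / a) ∂Q0|}) atTop (nhds 0) := by
  have hpos : ∀ n, 0 < g (n + 1) := fun n => hg1.trans_le (hg_mono (by omega))
  have hw : ∀ n, 0 < gfact n := fun n => by
    rw [hgfact]
    exact Finset.prod_pos fun j _ => hpos j
  obtain ⟨a₀, ha₀⟩ : ∃ a₀, a₀ = ⨅ x : ℤ, α x := ⟨_, rfl⟩
  rw [← ha₀] at hβinf
  have ha₀α : ∀ x, a₀ ≤ α x := fun x =>
    ha₀ ▸ ciInf_le ⟨0, by rintro _ ⟨y, rfl⟩; exact (hα y).1⟩ x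
  have ha₀pos : 0 < a₀ := hβ0.trans_lt hβinf
  obtain ⟨r, hbr, hr1⟩ := exists_between ((div_lt_one ha₀pos).2 hβinf)
  have hr0 : 0 < r := (div_nonneg hβ0 ha₀pos.le).trans_lt hbr
  have hratio : ∀ a, a₀ ≤ a → β / a ∈ Icc 0 r := fun a ha =>
    ⟨div_nonneg hβ0 (ha₀pos.le.trans ha), (div_le_div_of_nonneg_left hβ0 ha₀pos ha).trans hbr.le⟩
  have hsum : ∀ k : ℕ, Summable fun n : ℕ => (n : ℝ) ^ k * (r ^ n / gfact n) := fun k => by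
    simp_rw [hgfact]
    exact summable_pow_mul_pow_div_prod hpos hg_lim k hr0 hr1
  have hsum' : ∀ k : ℕ, ∀ t ∈ Icc 0 r, Summable fun n : ℕ => (n : ℝ) ^ k * (t ^ n / gfact n) := by
    intro k t ht
    have ht0 := ht.1
    have ht1 := ht.2
    refine Summable.of_nonneg_of_le (fun n => ?_) (fun n => ?_) (hsum k)
    · have := hw n
      positivity
    · have := hw n
      gcongr
  have hZ' : ∀ t, Z t = ∑' n : ℕ, (n : ℝ) ^ 0 * (t ^ n / gfact n) := fun t => by simp [hZ]
  have hZ1 : ∀ t ∈ Icc 0 r, 1 ≤ Z t := by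
    intro t ht
    have h0 : ((0 : ℕ) : ℝ) ^ 0 * (t ^ 0 / gfact 0) = 1 := by simp [hgfact]
    rw [hZ', ← h0]
    refine (hsum' 0 t ht).le_tsum 0 fun n _ => ?_
    have := hw n
    have := ht.1
    positivity
  have hmul : ∀ (k : ℕ) (t : ℝ) (n : ℕ), (n : ℝ) ^ k * θ t n = (Z t)⁻¹ * ((n : ℝ) ^ k * (t ^ n / gfact n)) :=
    fun k t n => by rw [hθ]; ring
  have hθ0 : ∀ t ∈ Icc 0 r, ∀ n, 0 ≤ θ t n := by
    intro t ht n
    have := hw n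
    have := ht.1
    have := hZ1 t ht
    rw [hθ]
    positivity
  have hθs : ∀ k : ℕ, ∀ t ∈ Icc 0 r, Summable fun n : ℕ => (n : ℝ) ^ k * θ t n := by
    intro k t ht
    simp_rw [hmul]
    exact (hsum' k t ht).mul_left _
  have hRcont : ContinuousOn R (Icc 0 r) := by
    have hcont : ∀ k : ℕ,
        ContinuousOn (fun t => ∑' n : ℕ, (n : ℝ) ^ k * (t ^ n / gfact n)) (Icc 0 r) := fun k =>
      continuousOn_tsum_mul_pow_div (fun n => by positivity) hw (hsum k)
    have hReq : R = fun t => (Z t)⁻¹ * ∑' n : ℕ, (n : ℝ) ^ 1 * (t ^ n / gfact n) := by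
      funext t
      rw [hR, ← tsum_mul_left]
      refine tsum_congr fun n => ?_
      rw [← hmul, pow_one]
    have hZc : ContinuousOn Z (Icc 0 r) := by
      rw [funext hZ']
      exact hcont 0
    rw [hReq]
    exact (hZc.inv₀ fun t ht => (zero_lt_one.trans_le (hZ1 t ht)).ne').mul (hcont 1)
  set φ : ℝ → ℝ := fun a => R (β / max a a₀) with hφ
  have hφcont : Continuous φ :=
    hRcont.comp_continuous
      (continuous_const.div (by fun_prop) fun a => (ha₀pos.trans_le (le_max_right _ _)).ne')
      fun a => hratio _ (le_max_right _ _)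
  have hφα : ∀ x, φ (α x) = R (β / α x) := fun x => by rw [hφ]; simp only [max_eq_left (ha₀α x)]
  have hφint : ∫ a, φ a ∂Q0 = ∫ a, R (β / a) ∂Q0 := by
    refine integral_congr_ae ?_
    filter_upwards [ae_le_of_tendsto_average (fun n : ℕ => ha₀α n) hQ0supp hright] with a ha
    simp only [hφ, max_eq_left ha]
  have hmarg : ∀ x n, μ {η | η x = n} = ENNReal.ofReal (θ (β / α x) n) := fun x n => by
    simpa using hμ {x} fun _ => n
  have hmom : ∀ (k : ℕ) x, Integrable (fun η : ℤ → ℕ => (η x : ℝ) ^ k) μ ∧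
      ∫ η, (η x : ℝ) ^ k ∂μ = ∑' n : ℕ, (n : ℝ) ^ k * θ (β / α x) n := fun k x =>
    integrable_comp_and_integral_eq_tsum (h := fun n : ℕ => (n : ℝ) ^ k) (measurable_pi_apply x)
      (hθ0 _ (hratio _ (ha₀α x))) (hmarg x) (fun n => by positivity) (hθs k _ (hratio _ (ha₀α x)))
  have hmean : ∀ x, ∫ η, (η x : ℝ) ∂μ = φ (α x) := fun x => by
    have := (hmom 1 x).2
    simp only [pow_one] at this
    rw [this, hφα, hR]
  have hmeas : ∀ x, Measurable fun η : ℤ → ℕ => (η x : ℝ) := fun x =>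
    (measurable_of_countable (fun n : ℕ => (n : ℝ))).comp (measurable_pi_apply x)
  have hL2 : ∀ x, MemLp (fun η : ℤ → ℕ => (η x : ℝ)) 2 μ := fun x =>
    (memLp_two_iff_integrable_sq (hmeas x).aestronglyMeasurable).2 (hmom 2 x).1
  have hvar : ∀ x, Var[fun η : ℤ → ℕ => (η x : ℝ); μ] ≤
      ∑' n : ℕ, (n : ℝ) ^ 2 * (r ^ n / gfact n) := by
    intro x
    refine (variance_le_expectation_sq (hmeas x).aestronglyMeasurable).trans ?_
    have ht := hratio _ (ha₀α x)
    refine (hmom 2 x).2.trans_le ((hθs 2 _ ht).tsum_le_tsum (fun n => ?_) (hsum 2))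
    have h0 := ht.1
    have h1 := ht.2
    have h2 := hw n
    rw [hmul]
    refine (mul_le_of_le_one_left (by positivity) (inv_le_one_of_one_le₀ (hZ1 _ ht))).trans ?_
    gcongr
  have hindep : ∀ x y, x ≠ y →
      IndepFun (fun η : ℤ → ℕ => (η x : ℝ)) (fun η : ℤ → ℕ => (η y : ℝ)) μ := by
    intro x y hxy
    have h : IndepFun (fun η : ℤ → ℕ => η x) (fun η : ℤ → ℕ => η y) μ := by
      refine indepFun_of_measure_eq_mul (measurable_pi_apply x) (measurable_pi_apply y)
        fun m n => ?_
      have := hμ {x, y} fun z => if z = x then m else n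
      rw [Finset.prod_pair hxy] at this
      simpa [hxy.symm, hmarg] using this
    exact h.comp (measurable_of_countable fun n : ℕ => (n : ℝ))
      (measurable_of_countable fun n : ℕ => (n : ℝ))
  have main : ∀ e : ℕ → ℤ, Function.Injective e →
      Tendsto (fun n : ℕ => ((n : ℝ) + 1)⁻¹ * ∑ x ∈ Finset.range (n + 1), φ (α (e x)))
        atTop (nhds (∫ a, φ a ∂Q0)) → ∀ δ > (0 : ℝ),
      Tendsto (fun n : ℕ => μ {η : ℤ → ℕ |
          δ < |((n : ℝ) + 1)⁻¹ * (∑ x ∈ Finset.range (n + 1), (η (e x) : ℝ)) -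
               ∫ a, R (β / a) ∂Q0|}) atTop (nhds 0) := by
    intro e he hlim δ hδ
    have hm : Tendsto (fun n : ℕ => ((n : ℝ) + 1)⁻¹ *
        ∑ i ∈ Finset.range (n + 1), ∫ η : ℤ → ℕ, (η (e i) : ℝ) ∂μ)
        atTop (nhds (∫ a, R (β / a) ∂Q0)) := by
      simpa only [hmean, ← hφint] using hlim
    have hX : ∀ i, MemLp ((fun (i : ℕ) (η : ℤ → ℕ) => (η (e i) : ℝ)) i) 2 μ := fun i => hL2 (e i)
    have hI : Pairwise fun i j => IndepFun ((fun (i : ℕ) (η : ℤ → ℕ) => (η (e i) : ℝ)) i)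
        ((fun (i : ℕ) (η : ℤ → ℕ) => (η (e i) : ℝ)) j) μ :=
      fun i j hij => hindep (e i) (e j) (he.ne hij)
    obtain ⟨C, hC⟩ : ∃ C, ∀ x, Var[fun η : ℤ → ℕ => (η x : ℝ); μ] ≤ C := ⟨_, hvar⟩
    exact tendsto_measure_lt_abs_average_sub hX hI (fun i => hC (e i)) hm hδ
  exact fun δ hδ => ⟨main (fun n => (n : ℤ)) Nat.cast_injective (hright φ hφcont) δ hδ,
    main (fun n => -(n : ℤ)) (neg_injective.comp Nat.cast_injective) (hleft φ hφcont) δ hδ⟩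
end

section
/- Let α : ℤ → [0,1] with c := inf_{x∈ℤ} α(x), and suppose there is a strictly increasing sequence (x_n)_{n∈ℤ} of integers with α(x_n) → c as n → ±∞ and x_{n+1}/x_n → 1 as n → ±∞. For ε > 0 and n ∈ ℤ define a_ε(τ_n α) := inf{x ≥ 0 : α(n+x) ≤ c+ε} and A_ε(τ_n α) := sup{x ≤ 0 : α(n+x) ≤ c+ε}. Then for every ε > 0, both a_ε(τ_n α)/n → 0 and A_ε(τ_n α)/n → 0 as n → +∞ and as n → −∞. -/
open Filter Set

/-- The members of a strictly increasing doubly infinite integer sequence cut `ℤ` into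
half-open intervals. -/
theorem StrictMono.exists_int_mem_Ico {x : ℤ → ℤ} (hx : StrictMono x) (n : ℤ) :
    ∃ k, x k ≤ n ∧ n < x (k + 1) := by
  have hstep (k : ℤ) : x k + 1 ≤ x (k + 1) := hx (lt_add_one k)
  have hmono : Monotone fun k => x k - k := monotone_int_of_le_succ fun k => by
    linarith [hstep k]
  obtain ⟨k, hk, hmax⟩ := Int.exists_greatest_of_bdd (P := fun k => x k ≤ n)
    ⟨max 0 (n - x 0), fun z hz => by
      by_contra! h
      have := hmono (show 0 ≤ z by omega)
      simp only at this
      omega⟩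
    ⟨min 0 (n - x 0), by
      have := hmono (show min 0 (n - x 0) ≤ 0 by omega)
      simp only at this
      omega⟩
  refine ⟨k, hk, ?_⟩
  by_contra! h
  have := hmax _ h
  omega

/-- The length of an interval `[p, q)` avoiding `0` is controlled, relative to any of its
points, by the ratio of its endpoints. -/
theorem sub_div_abs_le_of_div_pos {p q n : ℝ} (hpn : p ≤ n) (hnq : n ≤ q) (h : 0 < q / p) :
    (q - p) / |n| ≤ |q / p - 1| + |(q / p)⁻¹ - 1| := by
  rcases div_pos_iff.1 h with ⟨hq, hp⟩ | ⟨hq, hp⟩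
  · calc (q - p) / |n| ≤ (q - p) / p := by
          rw [abs_of_pos (hp.trans_le hpn)]
          gcongr
          linarith
      _ = q / p - 1 := by field_simp
      _ ≤ |q / p - 1| + |(q / p)⁻¹ - 1| := by
          linarith [le_abs_self (q / p - 1), abs_nonneg ((q / p)⁻¹ - 1)]
  · calc (q - p) / |n| ≤ (q - p) / (-q) := by
          rw [abs_of_neg (hnq.trans_lt hq)]
          gcongr <;> linarith
      _ = (q / p)⁻¹ - 1 := by
          have := hq.ne
          field_simp
          ring
      _ ≤ |q / p - 1| + |(q / p)⁻¹ - 1| := by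
          linarith [le_abs_self ((q / p)⁻¹ - 1), abs_nonneg (q / p - 1)]

/-- A function bounded by the length of the cell of `x` containing its argument is `o(n)` along
any filter along which consecutive members of `x` have ratio tending to `1`. -/
theorem tendsto_div_of_abs_le_gap {l : Filter ℤ} {x k F : ℤ → ℤ}
    (hk : ∀ n, x (k n) ≤ n ∧ n < x (k n + 1)) (hkl : Tendsto k l l)
    (hratio : Tendsto (fun n => (x (n + 1) : ℝ) / (x n : ℝ)) l (nhds 1))
    (hF : ∀ᶠ n in l, |F n| ≤ x (k n + 1) - x (k n)) :
    Tendsto (fun n : ℤ => (F n : ℝ) / (n : ℝ)) l (nhds 0) := by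
  have hr := hratio.comp hkl
  have hbound : Tendsto (fun n => |(x (k n + 1) : ℝ) / x (k n) - 1| +
      |((x (k n + 1) : ℝ) / x (k n))⁻¹ - 1|) l (nhds 0) := by
    simpa using (hr.sub_const 1).abs.add (((hr.inv₀ one_ne_zero).sub_const 1).abs)
  refine squeeze_zero_norm' ?_ hbound
  filter_upwards [hF, hr.eventually (lt_mem_nhds zero_lt_one)] with n hn hpos
  have hn' : |(F n : ℝ)| ≤ x (k n + 1) - x (k n) := mod_cast hn
  rw [norm_div, Real.norm_eq_abs, Real.norm_eq_abs]
  refine (div_le_div_of_nonneg_right hn' (abs_nonneg _)).trans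
    (sub_div_abs_le_of_div_pos (n := (n : ℝ)) ?_ ?_ hpos)
  · exact_mod_cast (hk n).1
  · exact_mod_cast (hk n).2.le

theorem abs_sInf_le_of_mem {P : ℤ → Prop} {m : ℤ} (hm : 0 ≤ m) (hP : P m) :
    |sInf {m : ℤ | 0 ≤ m ∧ P m}| ≤ m := by
  have hbdd : BddBelow {m : ℤ | 0 ≤ m ∧ P m} := ⟨0, fun _ h => h.1⟩
  have hmem : sInf {m : ℤ | 0 ≤ m ∧ P m} ∈ {m : ℤ | 0 ≤ m ∧ P m} :=
    Int.csInf_mem ⟨m, hm, hP⟩ hbdd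
  rw [abs_of_nonneg hmem.1]
  exact csInf_le hbdd ⟨hm, hP⟩

theorem abs_sSup_le_of_mem {P : ℤ → Prop} {m : ℤ} (hm : m ≤ 0) (hP : P m) :
    |sSup {m : ℤ | m ≤ 0 ∧ P m}| ≤ -m := by
  have hbdd : BddAbove {m : ℤ | m ≤ 0 ∧ P m} := ⟨0, fun _ h => h.1⟩
  have hmem : sSup {m : ℤ | m ≤ 0 ∧ P m} ∈ {m : ℤ | m ≤ 0 ∧ P m} :=
    Int.csSup_mem ⟨m, hm, hP⟩ hbdd
  rw [abs_of_nonpos hmem.1]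
  exact neg_le_neg (le_csSup hbdd ⟨hm, hP⟩)

/-- Under Assumption 2 (macroscopically dense defects), the distances
`a_ε(τ_n α) := inf{x ≥ 0 : α(n+x) ≤ c+ε}` and `A_ε(τ_n α) := sup{x ≤ 0 : α(n+x) ≤ c+ε}`
to the nearest `(c+ε)`-slow site seen from site `n` are `o(n)` as `n → ±∞`. -/
theorem statement13
    (α : ℤ → ℝ) (hα : ∀ x, α x ∈ Set.Icc (0 : ℝ) 1)
    (c : ℝ) (hc : c = ⨅ x : ℤ, α x)
    -- Assumption 2: a strictly increasing doubly infinite sequence of defects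
    (x : ℤ → ℤ) (hx_mono : StrictMono x)
    (hx_top : Tendsto (fun n => α (x n)) atTop (nhds c))
    (hx_bot : Tendsto (fun n => α (x n)) atBot (nhds c))
    (hx_ratio_top : Tendsto (fun n => (x (n + 1) : ℝ) / (x n : ℝ)) atTop (nhds 1))
    (hx_ratio_bot : Tendsto (fun n => (x (n + 1) : ℝ) / (x n : ℝ)) atBot (nhds 1))
    -- the defect distances seen from site n
    (a A : ℝ → ℤ → ℤ)
    (ha : ∀ ε n, a ε n = sInf {m : ℤ | 0 ≤ m ∧ α (n + m) ≤ c + ε})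
    (hA : ∀ ε n, A ε n = sSup {m : ℤ | m ≤ 0 ∧ α (n + m) ≤ c + ε}) :
    ∀ ε > (0 : ℝ),
      Tendsto (fun n : ℤ => (a ε n : ℝ) / (n : ℝ)) atTop (nhds 0) ∧
      Tendsto (fun n : ℤ => (a ε n : ℝ) / (n : ℝ)) atBot (nhds 0) ∧
      Tendsto (fun n : ℤ => (A ε n : ℝ) / (n : ℝ)) atTop (nhds 0) ∧
      Tendsto (fun n : ℤ => (A ε n : ℝ) / (n : ℝ)) atBot (nhds 0) := by
  intro ε hε
  choose k hk using hx_mono.exists_int_mem_Ico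
  have hk_top : Tendsto k atTop atTop := tendsto_atTop.2 fun K => by
    filter_upwards [eventually_ge_atTop (x K)] with n hn
    have := hx_mono.lt_iff_lt.1 (hn.trans_lt (hk n).2)
    omega
  have hk_bot : Tendsto k atBot atBot := tendsto_atBot.2 fun K => by
    filter_upwards [eventually_le_atBot (x K)] with n hn
    exact hx_mono.le_iff_le.1 ((hk n).1.trans hn)
  have key {l : Filter ℤ} (hkl : Tendsto k l l) (hsucc : Tendsto (fun n : ℤ => n + 1) l l)
      (hα_lim : Tendsto (fun n => α (x n)) l (nhds c))
      (hratio : Tendsto (fun n => (x (n + 1) : ℝ) / (x n : ℝ)) l (nhds 1)) :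
      Tendsto (fun n : ℤ => (a ε n : ℝ) / (n : ℝ)) l (nhds 0) ∧
      Tendsto (fun n : ℤ => (A ε n : ℝ) / (n : ℝ)) l (nhds 0) := by
    have hslow : ∀ᶠ j in l, α (x j) ≤ c + ε :=
      hα_lim.eventually_le_const (lt_add_of_pos_right c hε)
    constructor
    · refine tendsto_div_of_abs_le_gap hk hkl hratio ?_
      filter_upwards [(hsucc.comp hkl).eventually hslow] with n hn
      rw [ha]
      have := abs_sInf_le_of_mem (P := fun m => α (n + m) ≤ c + ε)
        (sub_nonneg.2 (hk n).2.le) (by simpa using hn)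
      linarith [(hk n).1]
    · refine tendsto_div_of_abs_le_gap hk hkl hratio ?_
      filter_upwards [hkl.eventually hslow] with n hn
      rw [hA]
      have := abs_sSup_le_of_mem (P := fun m => α (n + m) ≤ c + ε)
        (sub_nonpos.2 (hk n).1) (by simpa using hn)
      linarith [(hk n).2]
  obtain ⟨ha_top, hA_top⟩ :=
    key hk_top (tendsto_atTop_add_const_right _ 1 tendsto_id) hx_top hx_ratio_top
  obtain ⟨ha_bot, hA_bot⟩ :=
    key hk_bot (tendsto_atBot_add_const_right _ 1 tendsto_id) hx_bot hx_ratio_bot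
  exact ⟨ha_top, ha_bot, hA_top, hA_bot⟩
end

section
/- Let K ≥ 1 and n ≥ 1 be integers, C1 > 0, and a_0, …, a_{K−1} ∈ [0, C1] with mean m := K^{-1} Σ_{k=0}^{K−1} a_k. Then there exists l ∈ {0, …, n−1} such that the number of indices k ∈ ℕ with kn + l ≤ K−1 and a_{kn+l} ≥ m/2 is at least m(K − n)/(2nC1). -/
/-- Markov-type bound: a finite family bounded above by `C` and with total at least `m` times its
size has many terms that are at least `m / 2`. -/
theorem card_mul_half_le_mul_card_filter {ι : Type*} (s : Finset ι) (a : ι → ℝ) (m C : ℝ)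
    (ha : ∀ i ∈ s, a i ≤ C) (hm0 : 0 ≤ m) (hm : m * s.card ≤ ∑ i ∈ s, a i) :
    m * s.card / 2 ≤ C * ((s.filter (fun i => m / 2 ≤ a i)).card : ℝ) := by
  have h_big : ∑ i ∈ s.filter (fun i => m / 2 ≤ a i), a i ≤
      (s.filter (fun i => m / 2 ≤ a i)).card • C :=
    Finset.sum_le_card_nsmul _ _ _ fun i hi => ha i (Finset.mem_filter.1 hi).1
  have h_small : ∑ i ∈ s.filter (fun i => ¬ m / 2 ≤ a i), a i ≤
      (s.filter (fun i => ¬ m / 2 ≤ a i)).card • (m / 2) :=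
    Finset.sum_le_card_nsmul _ _ _ fun i hi => (not_le.1 (Finset.mem_filter.1 hi).2).le
  have h_card : ((s.filter (fun i => ¬ m / 2 ≤ a i)).card : ℝ) ≤ s.card := by
    exact_mod_cast Finset.card_filter_le _ _
  rw [← Finset.sum_filter_add_sum_filter_not s (fun i => m / 2 ≤ a i)] at hm
  rw [nsmul_eq_mul] at h_big h_small
  linarith [mul_le_mul_of_nonneg_right h_card (div_nonneg hm0 zero_le_two)]

/-- Some residue class modulo `n` contains at least the average number of the `j < K` satisfying `p`;
these are counted through their quotients by `n`. -/
theorem exists_residue_card_le (K n : ℕ) (hn : 0 < n) (p : ℕ → Prop) [DecidablePred p] :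
    ∃ l < n, (((Finset.range K).filter p).card : ℝ) / n ≤
      (((Finset.range K).filter (fun k => k * n + l ≤ K - 1 ∧ p (k * n + l))).card : ℝ) := by
  have hn' : (0 : ℝ) < n := by exact_mod_cast hn
  obtain ⟨l, hl, h⟩ := Finset.exists_le_card_fiber_of_nsmul_le_card_of_maps_to
    (s := (Finset.range K).filter p) (t := Finset.range n) (f := fun j => j % n)
    (b := (((Finset.range K).filter p).card : ℝ) / n)
    (fun j _ => Finset.mem_range.2 (Nat.mod_lt j hn)) ⟨0, Finset.mem_range.2 hn⟩
    (by rw [Finset.card_range, nsmul_eq_mul, mul_div_cancel₀ _ hn'.ne'])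
  refine ⟨l, Finset.mem_range.1 hl, h.trans ?_⟩
  have h_div (j : ℕ) (hj : j % n = l) : j / n * n + l = j := by
    rw [← hj, Nat.div_add_mod']
  norm_cast
  refine Finset.card_le_card_of_injOn (fun j => j / n) (fun j hj => ?_) fun i hi j hj hij => ?_
  · simp only [Finset.coe_filter, Finset.mem_filter, Finset.mem_range, Set.mem_ofPred_eq] at hj ⊢
    rw [h_div j hj.2]
    exact ⟨(Nat.div_le_self j n).trans_lt hj.1.1, by omega, hj.1.2⟩
  · rw [← h_div i (Finset.mem_filter.1 hi).2, ← h_div j (Finset.mem_filter.1 hj).2]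
    simp only at hij
    rw [hij]

/-- (Pigeonhole estimate underlying Lemma 4.6.) Let `K, n ≥ 1`,
`C1 > 0` and `a_0, …, a_{K−1} ∈ [0, C1]` with mean `m`. Then some arithmetic
subsequence of step `n` contains at least `m(K−n)/(2nC1)` indices `k` with
`kn + l ≤ K−1` and `a_{kn+l} ≥ m/2`. -/
theorem statement15
    (K n : ℕ) (hK : 1 ≤ K) (hn : 1 ≤ n)
    (C1 : ℝ) (hC1 : 0 < C1)
    (a : ℕ → ℝ) (ha : ∀ k < K, a k ∈ Set.Icc (0 : ℝ) C1)
    (m : ℝ) (hm : m = (K : ℝ)⁻¹ * ∑ k ∈ Finset.range K, a k) :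
    ∃ l < n,
      m * ((K : ℝ) - (n : ℝ)) / (2 * (n : ℝ) * C1) ≤
      (((Finset.range K).filter (fun k => k * n + l ≤ K - 1 ∧ m / 2 ≤ a (k * n + l))).card : ℝ) := by
  have hK' : (0 : ℝ) < K := by exact_mod_cast hK
  have hn' : (0 : ℝ) < n := by exact_mod_cast hn
  have hm0 : 0 ≤ m := by
    rw [hm]
    exact mul_nonneg (inv_nonneg.2 hK'.le)
      (Finset.sum_nonneg fun k hk => (ha k (Finset.mem_range.1 hk)).1)
  have h_sum : m * (Finset.range K).card ≤ ∑ k ∈ Finset.range K, a k := by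
    rw [hm, Finset.card_range]
    field_simp
    rfl
  have h_many := card_mul_half_le_mul_card_filter (Finset.range K) a m C1
    (fun k hk => (ha k (Finset.mem_range.1 hk)).2) hm0 h_sum
  rw [Finset.card_range] at h_many
  obtain ⟨l, hl, h⟩ := exists_residue_card_le K n hn (fun j => m / 2 ≤ a j)
  refine ⟨l, hl, le_trans ?_ h⟩
  rw [div_le_div_iff₀ (by positivity) hn']
  nlinarith [mul_le_mul_of_nonneg_right h_many hn'.le, mul_nonneg hm0 (mul_nonneg hn'.le hn'.le)]
end
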